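/- arXiv:math/0512518 — 8 statements merged into one kernel-verified Lean document; each statement's English description precedes it below -/
import Mathlib

section
/- Let G be a finite simple graph and let k be a positive integer. Suppose that every subgraph H of G that contains at least one edge has an edge uv with d_H(u) + d_H(v) ≤ k + 1, where d_H denotes degree in H. Then G is k-edge-choosable: for every assignment L of a list (finite set) of colors to each edge of G with |L(e)| ≥ k for every edge e, there is a proper edge coloring of G choosing each edge's color from its list (a coloring in which any two distinct edges sharing an endpoint receive different colors). -/
/-- A proper edge coloring of `G` chosen from the lists `L`: every edge of `G` gets a
color from its own list, and distinct edges sharing an endpoint get distinct colors. -/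
def IsProperEdgeListColoring {V : Type*} (G : SimpleGraph V) (L : Sym2 V → Finset ℕ)
    (c : Sym2 V → ℕ) : Prop :=
  (∀ e ∈ G.edgeSet, c e ∈ L e) ∧
  (∀ e ∈ G.edgeSet, ∀ f ∈ G.edgeSet, e ≠ f → (∃ v, v ∈ e ∧ v ∈ f) → c e ≠ c f)

/-- A proper edge list coloring of `G` minus the edge `uv` extends to `G` by giving `uv` a color
of its list which does not occur on an adjacent edge. -/
theorem IsProperEdgeListColoring.update {V : Type*} [DecidableEq V] {G : SimpleGraph V}
    {L : Sym2 V → Finset ℕ} {c : Sym2 V → ℕ} {u v : V}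
    (hc : IsProperEdgeListColoring (G.deleteEdges {s(u, v)}) L c) {a : ℕ} (ha : a ∈ L s(u, v))
    (hu : ∀ w, G.Adj u w → w ≠ v → c s(u, w) ≠ a)
    (hv : ∀ w, G.Adj v w → w ≠ u → c s(v, w) ≠ a) :
    IsProperEdgeListColoring G L (Function.update c s(u, v) a) := by
  have key : ∀ f ∈ G.edgeSet, f ≠ s(u, v) → (∃ x, x ∈ s(u, v) ∧ x ∈ f) → c f ≠ a := by
    rintro f hf hne ⟨x, hx, hxf⟩
    obtain ⟨w, rfl⟩ := Sym2.mem_iff_exists.mp hxf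
    rcases Sym2.mem_iff.mp hx with rfl | rfl
    · exact hu w hf fun h => hne (by rw [h])
    · exact hv w hf fun h => hne (by rw [h, Sym2.eq_swap])
  have mem : ∀ f ∈ G.edgeSet, f ≠ s(u, v) → f ∈ (G.deleteEdges {s(u, v)}).edgeSet := by
    intro f hf hne
    rw [SimpleGraph.edgeSet_deleteEdges]
    exact ⟨hf, hne⟩
  refine ⟨fun e he => ?_, fun e he f hf hef hadj => ?_⟩
  · by_cases h : e = s(u, v)
    · subst h; simpa using ha
    · simpa [Function.update_of_ne h] using hc.1 e (mem e he h)
  · by_cases h : e = s(u, v)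
    · subst h
      rw [Function.update_self, Function.update_of_ne hef.symm]
      exact (key f hf hef.symm hadj).symm
    · by_cases h' : f = s(u, v)
      · subst h'
        rw [Function.update_self, Function.update_of_ne h]
        exact key e he h (hadj.imp fun _ => And.symm)
      · rw [Function.update_of_ne h, Function.update_of_ne h']
        exact hc.2 e (mem e he h) f (mem f hf h') hef hadj

/-- If `d(u) + d(v) ≤ k + 1` for an edge `uv`, then any `k` colors contain one that does not occur
on an edge adjacent to `uv`. -/
theorem exists_color_notMem_adjacent_edges {V : Type*} [Finite V] {G : SimpleGraph V} {k : ℕ}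
    {u v : V} (huv : G.Adj u v)
    (hdeg : (G.neighborSet u).ncard + (G.neighborSet v).ncard ≤ k + 1)
    (c : Sym2 V → ℕ) {S : Finset ℕ} (hS : k ≤ S.card) :
    ∃ a ∈ S, (∀ w, G.Adj u w → w ≠ v → c s(u, w) ≠ a) ∧
      (∀ w, G.Adj v w → w ≠ u → c s(v, w) ≠ a) := by
  set A := (fun w => c s(u, w)) '' (G.neighborSet u \ {v})
  set B := (fun w => c s(v, w)) '' (G.neighborSet v \ {u})
  have hA : A.ncard < (G.neighborSet u).ncard :=
    (Set.ncard_image_le (Set.toFinite _)).trans_lt (Set.ncard_sdiff_singleton_lt_of_mem huv)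
  have hB : B.ncard < (G.neighborSet v).ncard :=
    (Set.ncard_image_le (Set.toFinite _)).trans_lt (Set.ncard_sdiff_singleton_lt_of_mem huv.symm)
  have hAB : (A ∪ B).ncard < (S : Set ℕ).ncard := by
    have := Set.ncard_union_le A B
    rw [Set.ncard_coe_finset]
    omega
  obtain ⟨a, haS, ha⟩ := Set.exists_mem_notMem_of_ncard_lt_ncard hAB
    (((Set.toFinite _).image _).union ((Set.toFinite _).image _))
  exact ⟨a, haS, fun w hw hne h => ha (Or.inl ⟨w, ⟨hw, hne⟩, h⟩),
    fun w hw hne h => ha (Or.inr ⟨w, ⟨hw, hne⟩, h⟩)⟩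

/-- Let `G` be a finite simple graph and `k ≥ 1`.  If every subgraph `H`
of `G` containing an edge has an edge `uv` with `d_H(u) + d_H(v) ≤ k + 1`, then `G` is
`k`-edge-choosable. -/
theorem stmt_1 {V : Type*} [Fintype V] (G : SimpleGraph V) (k : ℕ) (hk : 1 ≤ k)
    (hsub : ∀ H : G.Subgraph, H.edgeSet.Nonempty →
      ∃ u v, H.Adj u v ∧ (H.neighborSet u).ncard + (H.neighborSet v).ncard ≤ k + 1)
    (L : Sym2 V → Finset ℕ) (hL : ∀ e ∈ G.edgeSet, k ≤ (L e).card) :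
    ∃ c, IsProperEdgeListColoring G L c := by
  classical
  suffices ∀ G' ≤ G, ∃ c, IsProperEdgeListColoring G' L c from this G le_rfl
  intro G'
  induction G' using WellFoundedLT.induction with
  | ind G' ih =>
    intro hle
    by_cases hne : G'.edgeSet.Nonempty
    · obtain ⟨u, v, huv, hdeg⟩ := hsub (SimpleGraph.toSubgraph G' hle) hne
      replace huv : G'.Adj u v := huv
      have hlt : G'.deleteEdges {s(u, v)} < G' := by
        refine (SimpleGraph.deleteEdges_le _).lt_of_ne fun h => ?_
        rw [← h] at huv
        simp at huv
      obtain ⟨c, hc⟩ := ih _ hlt (hlt.le.trans hle)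
      obtain ⟨a, ha, hu, hv⟩ :=
        exists_color_notMem_adjacent_edges huv hdeg c (hL s(u, v) (hle huv))
      exact ⟨_, hc.update ha hu hv⟩
    · exact ⟨fun _ => 0, fun e he => (hne ⟨e, he⟩).elim, fun e he => (hne ⟨e, he⟩).elim⟩
end

section
/- Let G be a finite simple graph with maximum degree Δ ≥ 3 such that every vertex of degree 2 has both of its neighbors of degree Δ. If G contains no 2-alternating cycle, then G has strictly more vertices of degree Δ than vertices of degree 2. -/
namespace SimpleGraph

variable {V : Type*} {G : SimpleGraph V}

lemma IsAcyclic.card_edgeFinset_lt [Fintype V] [Nonempty V] [Fintype G.edgeSet]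
    (hG : G.IsAcyclic) : G.edgeFinset.card < Fintype.card V := by
  classical
  obtain ⟨T, hGT, -, hT⟩ := (connected_top (V := V)).exists_isTree_le_of_le_of_isAcyclic le_top hG
  have hcard := hT.card_edgeFinset
  have hle := Finset.card_le_card (edgeFinset_mono hGT)
  lia

lemma Walk.getVert_mem_iff_odd {s : Set V} (hs : ∀ v w, G.Adj v w → (w ∈ s ↔ v ∉ s))
    {x y : V} (p : G.Walk x y) (hx : x ∉ s) {i : ℕ} (hi : i ≤ p.length) :
    p.getVert i ∈ s ↔ Odd i := by
  induction i with
  | zero => simpa using hx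
  | succ i ih =>
    rw [hs _ _ (p.adj_getVert_succ hi), ih (by lia), Nat.odd_add_one]

lemma isAcyclic_of_forall_isCycle_not_alternating {s : Set V}
    (hs : ∀ v w, G.Adj v w → (w ∈ s ↔ v ∉ s))
    (hno : ∀ (x : V) (p : G.Walk x x), p.IsCycle → Even p.length →
      ¬ ∀ i ≤ p.length, Odd i → p.getVert i ∈ s) : G.IsAcyclic := by
  classical
  have key : ∀ (x : V) (p : G.Walk x x), x ∉ s → ¬ p.IsCycle := by
    intro x p hx hp
    refine hno x p hp ?_ fun i hi hodd => (p.getVert_mem_iff_odd hs hx hi).2 hodd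
    rw [← Nat.not_odd_iff_even, ← p.getVert_mem_iff_odd hs hx le_rfl, p.getVert_length]
    exact hx
  intro x p hp
  by_cases hx : x ∈ s
  · have hadj := p.adj_snd hp.not_nil
    exact key _ _ (fun h => (hs _ _ hadj).1 h hx)
      (hp.rotate (p.getVert_mem_support 1))
  · exact key x p hx hp

end SimpleGraph

/-- Let `G` be a finite simple graph with maximum degree `Δ ≥ 3` in
which every vertex of degree 2 has both neighbors of degree `Δ`.  If `G` contains no
2-alternating cycle (a cycle `v₁w₁v₂w₂…v_kw_k` of even length `2k ≥ 4` whose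
odd-position vertices `w₁, …, w_k` all have degree 2 in `G`), then `G` has strictly more
vertices of degree `Δ` than vertices of degree 2. -/
theorem stmt_3 {V : Type*} [Fintype V] [DecidableEq V] (G : SimpleGraph V)
    [DecidableRel G.Adj]
    (hΔ : 3 ≤ G.maxDegree)
    (h2 : ∀ v, G.degree v = 2 → ∀ w, G.Adj v w → G.degree w = G.maxDegree)
    (hno : ¬ ∃ (x : V) (p : G.Walk x x), p.IsCycle ∧ Even p.length ∧ 4 ≤ p.length ∧
      ∀ (i : ℕ) (h : 2 * i + 1 < p.support.length),
        G.degree (p.support.get ⟨2 * i + 1, h⟩) = 2) :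
    (Finset.univ.filter fun v => G.degree v = 2).card <
      (Finset.univ.filter fun v => G.degree v = G.maxDegree).card := by
  classical
  set T := Finset.univ.filter fun v => G.degree v = 2 with hTdef
  set D := Finset.univ.filter fun v => G.degree v = G.maxDegree with hDdef
  have hT : ∀ v, v ∈ T ↔ G.degree v = 2 := by simp [hTdef]
  have hD : ∀ v, v ∈ D ↔ G.degree v = G.maxDegree := by simp [hDdef]
  have hdisj : Disjoint T D := by
    rw [Finset.disjoint_left]
    intro v hv hv'
    rw [hT] at hv
    rw [hD] at hv'
    lia
  let H := G.between (T : Set V) (D : Set V)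
  have hbip : H.IsBipartiteWith (T : Set V) (D : Set V) :=
    SimpleGraph.between_isBipartiteWith (Finset.disjoint_coe.2 hdisj)
  have hHG : H ≤ G := SimpleGraph.between_le
  have hacyc : H.IsAcyclic := by
    refine SimpleGraph.isAcyclic_of_forall_isCycle_not_alternating (s := (T : Set V)) ?_ ?_
    · intro v w hvw
      rcases hbip.mem_of_adj hvw with ⟨hv, hw⟩ | ⟨hv, hw⟩
      · simpa [hv] using Finset.disjoint_right.1 hdisj hw
      · simpa [hw] using Finset.disjoint_right.1 hdisj hv
    · intro x p hp heven hodd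
      refine hno ⟨x, p.mapLe hHG, hp.mapLe hHG, by simpa using heven, ?_, ?_⟩
      · have := hp.three_le_length
        rw [SimpleGraph.Walk.length_map]
        obtain ⟨k, hk⟩ := heven
        lia
      · intro i h
        have hlen : 2 * i + 1 ≤ p.length := by simpa using h
        rw [List.get_eq_getElem, SimpleGraph.Walk.support_getElem_eq_getVert,
          SimpleGraph.Walk.getVert_map]
        exact (hT _).1 (hodd _ hlen ⟨i, rfl⟩)
  have hdeg : ∀ v ∈ T, H.degree v = 2 := by
    intro v hv
    rw [← (hT v).1 hv, ← SimpleGraph.card_neighborFinset_eq_degree,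
      ← SimpleGraph.card_neighborFinset_eq_degree]
    congr 1
    ext w
    rw [SimpleGraph.mem_neighborFinset, SimpleGraph.mem_neighborFinset]
    refine ⟨fun h => hHG h, fun h => SimpleGraph.between_adj.2 ⟨h, Or.inl ⟨hv, ?_⟩⟩⟩
    exact (hD w).2 (h2 v ((hT v).1 hv) w h)
  have hedges : H.edgeFinset.card = 2 * T.card := by
    rw [← SimpleGraph.isBipartiteWith_sum_degrees_eq_card_edges hbip,
      Finset.sum_congr rfl hdeg, Finset.sum_const, smul_eq_mul, mul_comm]
  have hsupp : H.support ⊆ ((T ∪ D : Finset V) : Set V) := by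
    simpa using SimpleGraph.isBipartiteWith_support_subset hbip
  have hne : Nonempty V := by
    by_contra h
    rw [not_nonempty_iff] at h
    simp at hΔ
  obtain ⟨m, hm⟩ := G.exists_maximal_degree_vertex
  have : Nonempty ((T ∪ D : Finset V) : Set V) :=
    ⟨m, Finset.mem_union_right _ ((hD m).2 hm.symm)⟩
  have hlt : H.edgeFinset.card < (T ∪ D).card := by
    rw [← SimpleGraph.card_edgeFinset_induce_of_support_subset hsupp, ← Fintype.card_coe (T ∪ D)]
    convert (hacyc.induce ((T ∪ D : Finset V) : Set V)).card_edgeFinset_lt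
    exact Finset.mem_coe.symm
  rw [hedges, Finset.card_union_of_disjoint hdisj] at hlt
  lia
end

section
/- Let G be a finite simple graph and let k be an integer with k ≥ 9. Suppose that every subgraph H of G that contains at least one edge has an edge uv with d_H(u) ≤ 4 and d_H(u) + d_H(v) ≤ k, where d_H denotes degree in H. Then G is k-total-choosable: for every assignment L of a list (finite set) of colors to each vertex and each edge of G with |L(x)| ≥ k for every vertex or edge x, there is a proper total coloring of G choosing each element's color from its list. -/
/-- A proper total coloring of `G` chosen from the lists `Lv` (on vertices) and `Le`
(on edges): every vertex and every edge of `G` gets a color from its own list, adjacent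
vertices get distinct colors, distinct edges sharing an endpoint get distinct colors,
and every edge gets a color distinct from those of its two endpoints. -/
def IsProperTotalListColoring {V : Type*} (G : SimpleGraph V) (Lv : V → Finset ℕ)
    (Le : Sym2 V → Finset ℕ) (cv : V → ℕ) (ce : Sym2 V → ℕ) : Prop :=
  (∀ v, cv v ∈ Lv v) ∧
  (∀ e ∈ G.edgeSet, ce e ∈ Le e) ∧
  (∀ u v, G.Adj u v → cv u ≠ cv v) ∧
  (∀ e ∈ G.edgeSet, ∀ f ∈ G.edgeSet, e ≠ f → (∃ v, v ∈ e ∧ v ∈ f) → ce e ≠ ce f) ∧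
  (∀ e ∈ G.edgeSet, ∀ v ∈ e, ce e ≠ cv v)

theorem Finset.exists_mem_notMem_of_ncard_lt {α : Type*} (L : Finset α) {S : Set α}
    (hS : S.Finite) (h : S.ncard < L.card) : ∃ c ∈ L, c ∉ S := by
  obtain ⟨c, hc, hcS⟩ := Set.exists_mem_notMem_of_ncard_lt_ncard
    (s := S) (t := (L : Set α)) (by simpa using h) hS
  exact ⟨c, by simpa using hc, hcS⟩

/-- A proper total list coloring of `H - uv` yields one of `H` when the degrees of `u` and `v`
are small: forget the color of `u`, color `uv`, and then color `u` again. -/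
theorem IsProperTotalListColoring.exists_of_deleteEdges {V : Type*} [Finite V]
    {H : SimpleGraph V} {Lv : V → Finset ℕ} {Le : Sym2 V → Finset ℕ} {cv : V → ℕ}
    {ce : Sym2 V → ℕ} {u v : V} (huv : H.Adj u v)
    (hu : 2 * (H.neighborSet u).ncard < (Lv u).card)
    (hsum : (H.neighborSet u).ncard + (H.neighborSet v).ncard ≤ (Le s(u, v)).card)
    (hc : IsProperTotalListColoring (H.deleteEdges {s(u, v)}) Lv Le cv ce) :
    ∃ cv' ce', IsProperTotalListColoring H Lv Le cv' ce' := by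
  classical
  obtain ⟨hLv, hLe, hvv, hee, hev⟩ := hc
  obtain ⟨a, haL, ha⟩ : ∃ a ∈ Le s(u, v),
      a ∉ (fun w => ce s(u, w)) '' (H.neighborSet u \ {v}) ∪
        (fun w => ce s(v, w)) '' (H.neighborSet v \ {u}) ∪ {cv v} := by
    refine Finset.exists_mem_notMem_of_ncard_lt _ (Set.toFinite _) ?_
    have h1 := Set.ncard_sdiff_singleton_add_one (s := H.neighborSet u) (a := v) huv
    have h2 := Set.ncard_sdiff_singleton_add_one (s := H.neighborSet v) (a := u) huv.symm
    grw [Set.ncard_union_le, Set.ncard_union_le, Set.ncard_image_le, Set.ncard_image_le,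
      Set.ncard_singleton]
    omega
  set ce' : Sym2 V → ℕ := Function.update ce s(u, v) a with hce'
  obtain ⟨b, hbL, hb⟩ : ∃ b ∈ Lv u,
      b ∉ (fun w => ce' s(u, w)) '' H.neighborSet u ∪ cv '' H.neighborSet u := by
    refine Finset.exists_mem_notMem_of_ncard_lt _ (Set.toFinite _) ?_
    grw [Set.ncard_union_le, Set.ncard_image_le, Set.ncard_image_le]
    omega
  simp only [Set.mem_union, Set.mem_image, Set.mem_sdiff, Set.mem_singleton_iff,
    SimpleGraph.mem_neighborSet, not_or, not_exists, not_and] at ha hb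
  obtain ⟨⟨hau, hav⟩, hacv⟩ := ha
  obtain ⟨hbe, hbv⟩ := hb
  have hdel : ∀ e ∈ H.edgeSet, e ≠ s(u, v) → e ∈ (H.deleteEdges {s(u, v)}).edgeSet := by
    intro e he hne
    rw [SimpleGraph.edgeSet_deleteEdges]
    exact ⟨he, hne⟩
  have hnew : ∀ e ∈ H.edgeSet, e ≠ s(u, v) → (∃ w, w ∈ e ∧ w ∈ s(u, v)) → ce e ≠ a := by
    rintro e he hne ⟨w, hwe, hw⟩
    obtain ⟨x, rfl⟩ := hwe
    rcases Sym2.mem_iff.mp hw with rfl | rfl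
    · exact hau x ⟨he, fun h => hne (by rw [h])⟩
    · exact hav x ⟨he, fun h => hne (by rw [h, Sym2.eq_swap])⟩
  refine ⟨Function.update cv u b, ce', ?_, ?_, ?_, ?_, ?_⟩
  · intro w
    by_cases hw : w = u
    · subst hw; simpa using hbL
    · simpa [hw] using hLv w
  · intro e he
    by_cases h : e = s(u, v)
    · subst h; simpa [hce'] using haL
    · simpa [hce', h] using hLe e (hdel e he h)
  · intro x y hxy
    by_cases hx : x = u
    · subst hx
      simpa [hxy.ne'] using fun h => hbv y hxy h.symm
    · by_cases hy : y = u
      · subst hy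
        simpa [hx] using hbv x hxy.symm
      · simpa [hx, hy] using hvv x y (hdel s(x, y) hxy (by aesop))
  · intro e he f hf hef hw
    by_cases h : e = s(u, v)
    · subst h
      obtain ⟨w, h1, h2⟩ := hw
      simpa [hce', hef.symm] using (hnew f hf hef.symm ⟨w, h2, h1⟩).symm
    · by_cases h' : f = s(u, v)
      · subst h'
        simpa [hce', h] using hnew e he h hw
      · simpa [hce', h, h'] using hee e (hdel e he h) f (hdel f hf h') hef hw
  · rintro e he w hw
    by_cases hwu : w = u
    · subst hwu
      obtain ⟨x, rfl⟩ := hw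
      simpa using hbe x he
    · by_cases h : e = s(u, v)
      · subst h
        obtain rfl : w = v := (Sym2.mem_iff.mp hw).resolve_left hwu
        simpa [hce', hwu] using hacv
      · simpa [hce', h, hwu] using hev e (hdel e he h) w hw

/-- Let `G` be a finite simple graph and `k ≥ 9`.  If every subgraph
`H` of `G` containing an edge has an edge `uv` with `d_H(u) ≤ 4` and
`d_H(u) + d_H(v) ≤ k`, then `G` is `k`-total-choosable. -/
theorem stmt_4 {V : Type*} [Fintype V] (G : SimpleGraph V) (k : ℕ) (hk : 9 ≤ k)
    (hsub : ∀ H : G.Subgraph, H.edgeSet.Nonempty →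
      ∃ u v, H.Adj u v ∧ (H.neighborSet u).ncard ≤ 4 ∧
        (H.neighborSet u).ncard + (H.neighborSet v).ncard ≤ k)
    (Lv : V → Finset ℕ) (Le : Sym2 V → Finset ℕ)
    (hLv : ∀ v, k ≤ (Lv v).card) (hLe : ∀ e ∈ G.edgeSet, k ≤ (Le e).card) :
    ∃ cv ce, IsProperTotalListColoring G Lv Le cv ce := by
  suffices ∀ H : SimpleGraph V, H ≤ G → ∃ cv ce, IsProperTotalListColoring H Lv Le cv ce from
    this G le_rfl
  intro H
  induction H using WellFoundedLT.induction with
  | ind H ih =>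
    intro hHG
    by_cases hne : H.edgeSet.Nonempty
    · obtain ⟨u, v, huv, hu, hs⟩ := hsub (SimpleGraph.toSubgraph H hHG) hne
      change H.Adj u v at huv
      change (H.neighborSet u).ncard ≤ 4 at hu
      change (H.neighborSet u).ncard + (H.neighborSet v).ncard ≤ k at hs
      have hlt : H.deleteEdges {s(u, v)} < H := by
        refine lt_of_le_of_ne (SimpleGraph.deleteEdges_le _) fun h => ?_
        rw [← h] at huv
        simp at huv
      obtain ⟨cv, ce, hc⟩ := ih _ hlt (hlt.le.trans hHG)
      have hku := hLv u
      exact hc.exists_of_deleteEdges huv (by omega) (hs.trans (hLe _ (hHG huv)))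
    · obtain rfl : H = ⊥ := by
        rwa [Set.not_nonempty_iff_eq_empty, SimpleGraph.edgeSet_eq_empty] at hne
      have hL : ∀ v, ∃ c, c ∈ Lv v := fun v => Finset.card_pos.mp (by have := hLv v; omega)
      choose cv hcv using hL
      exact ⟨cv, fun _ => 0, hcv, by simp, by simp, by simp, by simp⟩
end

section
/- Let G be a finite simple graph with maximum degree Δ(G) ≤ k for an integer k ≥ 2. Suppose that every subgraph H of G that contains at least one edge either (i) has an edge uv with d_H(u) + d_H(v) ≤ k + 1, or (ii) contains a 2-alternating cycle, i.e., a cycle v₁w₁v₂w₂…v_mw_m of even length 2m (m ≥ 2) in which each vertex w_i has degree exactly 2 in H. Then G is k-edge-choosable: for every assignment L of a list (finite set) of colors to each edge of G with |L(e)| ≥ k for every edge e, there is a proper edge coloring of G choosing each edge's color from its list. -/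
open SimpleGraph

/-- Greedy coloring along a path: lists of size at least two allow prescribing the first color. -/
lemma exists_seq_ne_succ (M : ℕ → Finset ℕ) (hM : ∀ i, 2 ≤ (M i).card) {a : ℕ} (ha : a ∈ M 0) :
    ∃ g : ℕ → ℕ, g 0 = a ∧ (∀ i, g i ∈ M i) ∧ ∀ i, g (i + 1) ≠ g i := by
  have step : ∀ i b, ∃ d ∈ M (i + 1), d ≠ b := fun i b =>
    Finset.exists_mem_ne (by have := hM (i + 1); omega) b
  choose s hs hne using step
  refine ⟨fun i => Nat.rec a (fun i b => s i b) i, rfl, fun i => ?_, fun i => hne _ _⟩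
  cases i with
  | zero => exact ha
  | succ i => exact hs _ _

lemma ZMod.val_add_one_eq {n : ℕ} [NeZero n] (x : ZMod n) :
    (x + 1).val = if x.val + 1 = n then 0 else x.val + 1 := by
  split_ifs with h
  · have : x + 1 = 0 := by
      rw [← ZMod.natCast_zmod_val x, ← Nat.cast_one, ← Nat.cast_add, h, ZMod.natCast_self]
    simp [this]
  · have hx := ZMod.val_lt x
    conv_lhs => rw [← ZMod.natCast_zmod_val x, ← Nat.cast_one, ← Nat.cast_add]
    exact ZMod.val_cast_of_lt (by omega)

/-- Even cycles are 2-choosable. -/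
lemma exists_zmod_coloring {n : ℕ} [NeZero n] (hn : Even n) (M : ZMod n → Finset ℕ)
    (hM : ∀ x, 2 ≤ (M x).card) :
    ∃ f : ZMod n → ℕ, (∀ x, f x ∈ M x) ∧ ∀ x, f (x + 1) ≠ f x := by
  by_cases h : ∀ x, M (x + 1) ⊆ M x
  · have hsub : ∀ (j : ℕ) (x : ZMod n), M (x + j) ⊆ M x := by
      intro j
      induction j with
      | zero => simp
      | succ j ih =>
        intro x
        have := (h (x + j)).trans (ih x)
        rwa [add_assoc, ← Nat.cast_succ] at this
    have hall : ∀ x, M 0 ⊆ M x := by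
      intro x
      have := hsub (-x).val x
      rwa [ZMod.natCast_zmod_val, add_neg_cancel] at this
    obtain ⟨a, ha, b, hb, hab⟩ := Finset.one_lt_card.1 (hM 0)
    refine ⟨fun x => if Even x.val then a else b, fun x => ?_, fun x => ?_⟩
    · dsimp only
      split_ifs
      exacts [hall x ha, hall x hb]
    · dsimp only
      rw [ZMod.val_add_one_eq]
      by_cases hx : x.val + 1 = n
      · have : ¬ Even x.val := by
          rw [← hx, Nat.even_add_one] at hn
          exact hn
        simp [hx, this, hab]
      · by_cases he : Even x.val <;> simp [hx, Nat.even_add_one, he, hab, hab.symm]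
  · push Not at h
    obtain ⟨i, hi⟩ := h
    obtain ⟨a, ha, ha'⟩ := Finset.not_subset.1 hi
    obtain ⟨g, hg0, hgM, hgne⟩ := exists_seq_ne_succ (fun j => M (i + 1 + j)) (fun _ => hM _)
      (a := a) (by simpa using ha)
    have hmem : ∀ x, g (x - (i + 1)).val ∈ M x := by
      intro x
      have := hgM (x - (i + 1)).val
      simpa using this
    refine ⟨fun x => g (x - (i + 1)).val, hmem, fun x => ?_⟩
    dsimp only
    rw [add_sub_right_comm, ZMod.val_add_one_eq]
    split_ifs with hx
    · have h0 : x - (i + 1) + 1 = 0 := by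
        rw [← ZMod.val_eq_zero, ZMod.val_add_one_eq, if_pos hx]
      have hxi : x = i := by linear_combination h0
      intro heq
      rw [hg0] at heq
      apply ha'
      rw [heq, ← hxi]
      simpa [hxi] using hmem x
    · exact hgne _

/-- Combine a coloring away from an edge set `S` with a compatible coloring of `S`. -/
lemma exists_coloring_of_deleteEdges {V : Type*} {H : SimpleGraph V} {L : Sym2 V → Finset ℕ}
    {S : Set (Sym2 V)} {c g : Sym2 V → ℕ} (hc : IsProperEdgeListColoring (H.deleteEdges S) L c)
    (hg : ∀ e ∈ S, g e ∈ L e)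
    (hgg : ∀ e ∈ S, ∀ f ∈ S, e ≠ f → (∃ v, v ∈ e ∧ v ∈ f) → g e ≠ g f)
    (hgc : ∀ e ∈ S, ∀ f ∈ H.edgeSet, f ∉ S → (∃ v, v ∈ e ∧ v ∈ f) → g e ≠ c f) :
    ∃ c', IsProperEdgeListColoring H L c' := by
  classical
  have hmem : ∀ e ∈ H.edgeSet, e ∉ S → e ∈ (H.deleteEdges S).edgeSet := by
    intro e he heS
    rw [edgeSet_deleteEdges]
    exact ⟨he, heS⟩
  refine ⟨fun e => if e ∈ S then g e else c e, fun e he => ?_, fun e he f hf hne hv => ?_⟩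
  · dsimp only
    split_ifs with h
    exacts [hg e h, hc.1 e (hmem e he h)]
  · dsimp only
    split_ifs with h1 h2 h2
    · exact hgg e h1 f h2 hne hv
    · exact hgc e h1 f hf h2 hv
    · exact (hgc f h2 e he h1 (hv.imp fun _ => And.symm)).symm
    · exact hc.2 e (hmem e he h1) f (hmem f hf h2) hne hv

/-- The colors used by `c` on the edges from `v` to its neighbors outside `A`. -/
noncomputable def usedColors {V : Type*} [Finite V] (H : SimpleGraph V) (c : Sym2 V → ℕ)
    (v : V) (A : Set V) : Finset ℕ :=
  ((Set.toFinite (H.neighborSet v \ A)).image fun w => c s(v, w)).toFinset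

lemma mem_usedColors {V : Type*} [Finite V] {H : SimpleGraph V} {c : Sym2 V → ℕ} {v w : V}
    {A : Set V} (h : H.Adj v w) (hw : w ∉ A) : c s(v, w) ∈ usedColors H c v A := by
  simp only [usedColors, Set.Finite.mem_toFinset]
  exact ⟨w, ⟨h, hw⟩, rfl⟩

lemma card_usedColors_add_le {V : Type*} [Finite V] {H : SimpleGraph V} (c : Sym2 V → ℕ) {v : V}
    {A : Set V} (hA : A ⊆ H.neighborSet v) :
    (usedColors H c v A).card + A.ncard ≤ (H.neighborSet v).ncard := by
  rw [usedColors, ← Set.ncard_eq_toFinset_card _ _, ← Set.ncard_sdiff_add_ncard_of_subset hA]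
  exact Nat.add_le_add_right (Set.ncard_image_le (Set.toFinite _)) _

/-- A coloring extends over an edge whose endpoints have small degree sum. -/
lemma exists_coloring_of_degree_sum_le {V : Type*} [Finite V] {H : SimpleGraph V}
    {L : Sym2 V → Finset ℕ} {c : Sym2 V → ℕ} {k : ℕ} {u v : V} (huv : H.Adj u v)
    (hL : k ≤ (L s(u, v)).card)
    (hdeg : (H.neighborSet u).ncard + (H.neighborSet v).ncard ≤ k + 1)
    (hc : IsProperEdgeListColoring (H.deleteEdges {s(u, v)}) L c) :
    ∃ c', IsProperEdgeListColoring H L c' := by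
  have h1 := card_usedColors_add_le (H := H) c (v := u) (A := {v}) (by simpa using huv)
  have h2 := card_usedColors_add_le (H := H) c (v := v) (A := {u}) (by simpa using huv.symm)
  rw [Set.ncard_singleton] at h1 h2
  have h3 := Finset.card_union_le (usedColors H c u {v}) (usedColors H c v {u})
  obtain ⟨a, ha, ha'⟩ := Finset.exists_mem_notMem_of_card_lt_card
    (s := usedColors H c u {v} ∪ usedColors H c v {u}) (t := L s(u, v)) (by omega)
  rw [Finset.mem_union, not_or] at ha'
  refine exists_coloring_of_deleteEdges (g := fun _ => a) hc ?_ ?_ ?_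
  · rintro _ rfl
    exact ha
  · rintro _ rfl _ rfl h
    exact absurd rfl h
  · rintro _ rfl f hf hfS ⟨w, hw, hwf⟩ rfl
    obtain ⟨y, rfl⟩ := Sym2.mem_iff_exists.1 hwf
    rw [mem_edgeSet] at hf
    rcases Sym2.mem_iff.1 hw with rfl | rfl
    · exact ha'.1 (mem_usedColors hf fun h => hfS (by rw [Set.mem_singleton_iff] at h ⊢; rw [h]))
    · exact ha'.2 (mem_usedColors hf fun h => hfS (by
        rw [Set.mem_singleton_iff] at h ⊢; rw [h, Sym2.eq_swap]))

/-- A coloring extends over an even cycle in which consecutive vertices have small degree sum. -/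
lemma exists_coloring_of_even_cycle {V : Type*} [Finite V] {H : SimpleGraph V}
    {L : Sym2 V → Finset ℕ} {c : Sym2 V → ℕ} {k n : ℕ} (hn : Even n) (hn3 : 3 ≤ n)
    {u : ZMod n → V} (hu : Function.Injective u) (hadj : ∀ x, H.Adj (u x) (u (x + 1)))
    (hL : ∀ e ∈ H.edgeSet, k ≤ (L e).card)
    (hdeg : ∀ x, (H.neighborSet (u x)).ncard + (H.neighborSet (u (x + 1))).ncard ≤ k + 2)
    (hc : IsProperEdgeListColoring
      (H.deleteEdges (Set.range fun x => s(u x, u (x + 1)))) L c) :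
    ∃ c', IsProperEdgeListColoring H L c' := by
  have : NeZero n := ⟨by omega⟩
  have h2 : (2 : ZMod n) ≠ 0 := by
    intro h
    have h' : ((2 : ℕ) : ZMod n) = 0 := by exact_mod_cast h
    rw [ZMod.natCast_eq_zero_iff] at h'
    have := Nat.le_of_dvd (by norm_num) h'
    omega
  have hE : Function.Injective fun x => s(u x, u (x + 1)) := by
    intro x y hxy
    rcases Sym2.eq_iff.1 hxy with ⟨h, -⟩ | ⟨h, h'⟩
    · exact hu h
    · refine absurd ?_ h2
      linear_combination hu h' - hu h
  let A : ZMod n → Set V := fun x => {u (x - 1), u (x + 1)}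
  let F : ZMod n → Finset ℕ := fun x => usedColors H c (u x) (A x)
  have hF : ∀ x, (F x).card + 2 ≤ (H.neighborSet (u x)).ncard := by
    intro x
    have hA : (A x).ncard = 2 := by
      refine Set.ncard_pair fun h => h2 ?_
      linear_combination - hu h
    rw [← hA]
    refine card_usedColors_add_le c ?_
    rintro _ (rfl | rfl)
    · have := (hadj (x - 1)).symm
      rwa [sub_add_cancel] at this
    · exact hadj x
  obtain ⟨f, hfM, hf⟩ := exists_zmod_coloring hn
    (fun x => L s(u x, u (x + 1)) \ (F x ∪ F (x + 1))) (fun x => by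
      have h1 := Finset.card_union_le (F x) (F (x + 1))
      have h2 := Finset.le_card_sdiff (F x ∪ F (x + 1)) (L s(u x, u (x + 1)))
      have := hF x
      have := hF (x + 1)
      have := hdeg x
      have := hL _ ((mem_edgeSet H).2 (hadj x))
      omega)
  simp only [Finset.mem_sdiff, Finset.mem_union, not_or] at hfM
  have key : ∀ {x w y}, w = u x → H.Adj w y →
      s(w, y) ∉ Set.range (fun x => s(u x, u (x + 1))) → c s(w, y) ∈ F x := by
    rintro x w y rfl hy hnot
    refine mem_usedColors hy ?_
    rintro (rfl | rfl)
    · exact hnot ⟨x - 1, by simp [Sym2.eq_swap]⟩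
    · exact hnot ⟨x, rfl⟩
  refine exists_coloring_of_deleteEdges (g := Function.extend (fun x => s(u x, u (x + 1))) f c)
    hc ?_ ?_ ?_
  · rintro _ ⟨x, rfl⟩
    rw [hE.extend_apply]
    exact (hfM x).1
  · rintro _ ⟨x, rfl⟩ _ ⟨y, rfl⟩ hne ⟨w, hw, hw'⟩
    rw [hE.extend_apply, hE.extend_apply]
    rcases Sym2.mem_iff.1 hw with rfl | rfl <;> rcases Sym2.mem_iff.1 hw' with h | h
    · exact absurd (by rw [hu h]) hne
    · rw [hu h]
      exact hf y
    · rw [← hu h]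
      exact (hf x).symm
    · exact absurd (by rw [add_right_cancel (hu h)]) hne
  · rintro _ ⟨x, rfl⟩ e he heS ⟨w, hw, hwe⟩ heq
    rw [hE.extend_apply] at heq
    obtain ⟨y, rfl⟩ := Sym2.mem_iff_exists.1 hwe
    rw [mem_edgeSet] at he
    rcases Sym2.mem_iff.1 hw with h | h
    · exact (hfM x).2.1 (heq ▸ key h he heS)
    · exact (hfM x).2.2 (heq ▸ key h he heS)

/-- The vertices of a cycle, indexed cyclically. -/
lemma SimpleGraph.Walk.IsCycle.exists_zmod {V : Type*} {H : SimpleGraph V} {x : V} {p : H.Walk x x}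
    (hp : p.IsCycle) :
    ∃ u : ZMod p.length → V, Function.Injective u ∧ (∀ i, u i = p.getVert i.val) ∧
      ∀ i, u (i + 1) = p.getVert (i.val + 1) := by
  have hlen := hp.three_le_length
  have : NeZero p.length := ⟨by omega⟩
  refine ⟨fun i => p.getVert i.val, fun i j hij => ?_, fun _ => rfl, fun i => ?_⟩
  · have hi := ZMod.val_lt i
    have hj := ZMod.val_lt j
    refine ZMod.val_injective _ (hp.getVert_injOn' ?_ ?_ hij) <;> simp only [Set.mem_ofPred_eq] <;>
      omega
  · dsimp only
    rw [ZMod.val_add_one_eq]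
    split_ifs with h
    · rw [h, Walk.getVert_length, Walk.getVert_zero]
    · rfl

/-- Let `G` be a finite simple graph with maximum degree at most `k`,
where `k ≥ 2`.  Suppose every subgraph `H` of `G` containing an edge either (i) has an
edge `uv` with `d_H(u) + d_H(v) ≤ k + 1`, or (ii) contains a 2-alternating cycle, i.e. a
cycle of even length `2m ≥ 4` whose odd-position vertices all have degree exactly 2 in
`H`.  Then `G` is `k`-edge-choosable. -/
theorem stmt_5 {V : Type*} [Fintype V] (G : SimpleGraph V) [DecidableRel G.Adj]
    (k : ℕ) (hk : 2 ≤ k) (hΔ : G.maxDegree ≤ k)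
    (hsub : ∀ H : G.Subgraph, H.edgeSet.Nonempty →
      (∃ u v, H.Adj u v ∧ (H.neighborSet u).ncard + (H.neighborSet v).ncard ≤ k + 1) ∨
      (∃ (x : V) (p : H.spanningCoe.Walk x x), p.IsCycle ∧ Even p.length ∧
        4 ≤ p.length ∧ ∀ (i : ℕ) (h : 2 * i + 1 < p.support.length),
          (H.neighborSet (p.support.get ⟨2 * i + 1, h⟩)).ncard = 2))
    (L : Sym2 V → Finset ℕ) (hL : ∀ e ∈ G.edgeSet, k ≤ (L e).card) :
    ∃ c, IsProperEdgeListColoring G L c := by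
  classical
  have main : ∀ (m : ℕ) (H : SimpleGraph V), H ≤ G → H.edgeSet.ncard = m →
      ∃ c, IsProperEdgeListColoring H L c := by
    intro m
    induction m using Nat.strong_induction_on with
    | _ m ih =>
    rintro H hH rfl
    have hdelete : ∀ S ⊆ H.edgeSet, S.Nonempty →
        ∃ c, IsProperEdgeListColoring (H.deleteEdges S) L c := by
      rintro S hS ⟨e, he⟩
      refine ih _ ?_ _ ((H.deleteEdges_le S).trans hH) rfl
      rw [edgeSet_deleteEdges]
      exact Set.ncard_lt_ncard ⟨Set.sdiff_subset, fun h => (h (hS he)).2 he⟩ (Set.toFinite _)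
    have hdeg : ∀ v, (H.neighborSet v).ncard ≤ k := by
      intro v
      calc (H.neighborSet v).ncard ≤ (G.neighborSet v).ncard :=
            Set.ncard_le_ncard (fun w hw => hH hw) (Set.toFinite _)
        _ = G.degree v := by
            rw [Set.ncard_eq_toFinset_card', ← card_neighborFinset_eq_degree, neighborFinset]
        _ ≤ k := (G.degree_le_maxDegree v).trans hΔ
    have hLH : ∀ e ∈ H.edgeSet, k ≤ (L e).card := fun e he => hL e (edgeSet_mono hH he)
    rcases H.edgeSet.eq_empty_or_nonempty with hemp | hne
    · exact ⟨fun _ => 0, by simp [IsProperEdgeListColoring, hemp]⟩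
    rcases hsub (toSubgraph H hH) hne with ⟨u, v, huv, hsum⟩ | ⟨x, p, hp, heven, -, hodd⟩
    · have huv : H.Adj u v := huv
      obtain ⟨c, hc⟩ := hdelete {s(u, v)} (by simpa using huv) (Set.singleton_nonempty _)
      exact exists_coloring_of_degree_sum_le huv (hLH _ huv) hsum hc
    · obtain ⟨x, p, hp, heven, hodd⟩ : ∃ (x : V) (p : H.Walk x x), p.IsCycle ∧ Even p.length ∧
          ∀ (i : ℕ) (h : 2 * i + 1 < p.support.length),
            (H.neighborSet (p.support.get ⟨2 * i + 1, h⟩)).ncard = 2 := ⟨x, p, hp, heven, hodd⟩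
      obtain ⟨u, hu, hval, hsucc⟩ := hp.exists_zmod
      have hlen := hp.three_le_length
      have : NeZero p.length := ⟨by omega⟩
      have hadj : ∀ i, H.Adj (u i) (u (i + 1)) := by
        intro i
        rw [hval, hsucc]
        exact p.adj_getVert_succ (ZMod.val_lt i)
      have htwo : ∀ j, Odd j → j ≤ p.length → (H.neighborSet (p.getVert j)).ncard = 2 := by
        rintro _ ⟨i, rfl⟩ hi
        have hlt : 2 * i + 1 < p.support.length := by
          rw [Walk.length_support]
          omega
        have := hodd i hlt
        rw [List.get_eq_getElem, Walk.support_getElem_eq_getVert] at this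
        exact this
      obtain ⟨c, hc⟩ := hdelete (Set.range fun i => s(u i, u (i + 1)))
        (by rintro _ ⟨i, rfl⟩; exact hadj i) (Set.range_nonempty _)
      refine exists_coloring_of_even_cycle heven hlen hu hadj hLH (fun i => ?_) hc
      have hi := ZMod.val_lt i
      rcases Nat.even_or_odd i.val with h | h
      · have h1 := htwo (i.val + 1) h.add_one hi
        rw [← hsucc] at h1
        have := hdeg (u i)
        omega
      · have h1 := htwo i.val h hi.le
        rw [← hval] at h1
        have := hdeg (u (i + 1))
        omega
  exact main _ G le_rfl rfl
end

section
/- Let G be a finite simple graph and let k be an integer with k ≥ 9 and maximum degree Δ(G) ≤ k − 1. Suppose that every subgraph H of G that contains at least one edge either (i) has an edge uv with d_H(u) ≤ 4 and d_H(u) + d_H(v) ≤ k, or (ii) contains a 2-alternating cycle, i.e., a cycle v₁w₁v₂w₂…v_mw_m of even length 2m (m ≥ 2) in which each vertex w_i has degree exactly 2 in H. Then G is k-total-choosable: for every assignment L of a list (finite set) of colors to each vertex and each edge of G with |L(x)| ≥ k for every vertex or edge x, there is a proper total coloring of G choosing each element's color from its list. -/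
/-- Along a path of edges with lists of size two, either all lists coincide, or some color of the
first edge is compatible with every color of the last edge. -/
theorem exists_path_or_const (L : ℕ → Finset ℕ) (hL : ∀ i, (L i).card = 2) (n : ℕ) :
    (∀ i ≤ n, L i = L 0) ∨
      ∃ x ∈ L 0, ∀ y ∈ L n, ∃ c : ℕ → ℕ,
        c 0 = x ∧ c n = y ∧ (∀ i ≤ n, c i ∈ L i) ∧ ∀ i < n, c i ≠ c (i + 1) := by
  have extend : ∀ (n : ℕ) (c : ℕ → ℕ) (y : ℕ), (∀ i ≤ n, c i ∈ L i) → (∀ i < n, c i ≠ c (i + 1)) →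
      y ∈ L (n + 1) → c n ≠ y → ∃ d : ℕ → ℕ, d 0 = c 0 ∧ d (n + 1) = y ∧
        (∀ i ≤ n + 1, d i ∈ L i) ∧ ∀ i < n + 1, d i ≠ d (i + 1) := by
    intro n c y h1 h2 hy hne
    refine ⟨fun i => if i ≤ n then c i else y, by simp, by simp, fun i hi => ?_, fun i hi => ?_⟩
    · rcases Nat.lt_or_ge n i with h | h
      · obtain rfl : i = n + 1 := by omega
        simpa using hy
      · simpa [h] using h1 i h
    · rcases Nat.lt_or_ge i n with h | h
      · simpa [h.le, Nat.succ_le_of_lt h] using h2 i h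
      · obtain rfl : i = n := by omega
        simpa using hne
  induction n with
  | zero => left; intro i hi; rw [Nat.le_zero.1 hi]
  | succ n ih =>
    rcases ih with ih | ⟨x, hx, ih⟩
    · by_cases h : L (n + 1) = L 0
      · left
        intro i hi
        rcases Nat.lt_or_ge n i with h' | h'
        · rwa [show i = n + 1 by omega]
        · exact ih i h'
      · right
        obtain ⟨a, ha, hna⟩ : ∃ a ∈ L 0, a ∉ L (n + 1) := by
          by_contra! hc
          exact h (Finset.eq_of_subset_of_card_le hc (by simp [hL])).symm
        obtain ⟨b, hb, hba⟩ := Finset.exists_mem_ne (by simp [hL]) a (s := L 0)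
        refine ⟨if Even n then a else b, by split_ifs <;> assumption, fun y hy => ?_⟩
        obtain ⟨d, h0, h1, h2, h3⟩ := extend n (fun i => if Even (n + i) then a else b) y
          (fun i hi => by rw [ih i hi]; split_ifs <;> assumption)
          (fun i hi => by
            have := hba.symm
            by_cases hp : Even (n + i)
            · simp [← add_assoc, Nat.even_add_one, hp, this]
            · simp [← add_assoc, Nat.even_add_one, hp, hba])
          hy (by
            simp only [Even.add_self, if_true]
            rintro rfl
            exact hna hy)
        exact ⟨d, by simpa using h0, h1, h2, h3⟩
    · right
      refine ⟨x, hx, fun y hy => ?_⟩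
      obtain ⟨z, hz, hzy⟩ := Finset.exists_mem_ne (by simp [hL]) y (s := L n)
      obtain ⟨c, h0, h1, h2, h3⟩ := ih z hz
      obtain ⟨d, g0, g1, g2, g3⟩ := extend n c y h2 h3 hy (by rwa [h1])
      exact ⟨d, g0.trans h0, g1, g2, g3⟩

/-- Even cycles are `2`-edge-choosable, stated for cyclic sequences of lists. -/
theorem exists_even_cycle_listColoring (n : ℕ) (hn : Even n) (hpos : 0 < n) (L : ℕ → Finset ℕ)
    (hL : ∀ i < n, 2 ≤ (L i).card) :
    ∃ c : ℕ → ℕ, (∀ i < n, c i ∈ L i) ∧ (∀ i, i + 1 < n → c i ≠ c (i + 1)) ∧ c (n - 1) ≠ c 0 := by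
  have hsub : ∀ i, ∃ T : Finset ℕ, (i < n → T ⊆ L i) ∧ T.card = 2 := by
    intro i
    by_cases hi : i < n
    · obtain ⟨T, h1, h2⟩ := Finset.exists_subset_card_eq (hL i hi)
      exact ⟨T, fun _ => h1, h2⟩
    · exact ⟨{0, 1}, fun h => absurd h hi, rfl⟩
  choose T hT hT2 using hsub
  rcases exists_path_or_const T hT2 (n - 1) with h | ⟨x, hx, h⟩
  · obtain ⟨a, b, hab, h0⟩ := Finset.card_eq_two.1 (hT2 0)
    refine ⟨fun i => if Even i then a else b, fun i hi => hT i hi ?_, fun i _ => ?_, ?_⟩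
    · rw [h i (by omega), h0]
      dsimp only
      split_ifs <;> simp
    · by_cases hp : Even i
      · simp [Nat.even_add_one, hp, hab]
      · simp [Nat.even_add_one, hp, hab.symm]
    · have : ¬ Even (n - 1) := by
        obtain ⟨m, rfl⟩ := hn
        rw [Nat.not_even_iff_odd]
        exact ⟨m - 1, by omega⟩
      simp [this, hab.symm]
  · obtain ⟨y, hy, hyx⟩ := Finset.exists_mem_ne (by simp [hT2]) x (s := T (n - 1))
    obtain ⟨c, h0, h1, h2, h3⟩ := h y hy
    exact ⟨c, fun i hi => hT i hi (h2 i (by omega)), fun i hi => h3 i (by omega),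
      by rwa [h0, h1]⟩

section TotalColoring

variable {V : Type*} (Lv : V → Finset ℕ) (Le : Sym2 V → Finset ℕ)

/-- A list total coloring all of whose conflicts involve the color of a vertex in `W`. -/
def IsProperTotalListColoringOff (G : SimpleGraph V) (W : Set V) (cv : V → ℕ)
    (ce : Sym2 V → ℕ) : Prop :=
  (∀ v, cv v ∈ Lv v) ∧
  (∀ e ∈ G.edgeSet, ce e ∈ Le e) ∧
  (∀ u v, G.Adj u v → u ∉ W → v ∉ W → cv u ≠ cv v) ∧
  (∀ e ∈ G.edgeSet, ∀ f ∈ G.edgeSet, e ≠ f → (∃ v, v ∈ e ∧ v ∈ f) → ce e ≠ ce f) ∧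
  (∀ e ∈ G.edgeSet, ∀ v ∈ e, v ∉ W → ce e ≠ cv v)

variable {Lv Le}

/-- Conflicts at vertices of degree at most `4` can be repaired by recoloring these vertices. -/
theorem IsProperTotalListColoringOff.exists_isProperTotalListColoring [Finite V]
    {G : SimpleGraph V} (W : Finset V) {cv : V → ℕ} {ce : Sym2 V → ℕ}
    (hW : ∀ w ∈ W, (G.neighborSet w).ncard ≤ 4) (hLv : ∀ v, 9 ≤ (Lv v).card)
    (h : IsProperTotalListColoringOff Lv Le G W cv ce) :
    ∃ cv', IsProperTotalListColoring G Lv Le cv' ce := by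
  classical
  induction W using Finset.induction_on generalizing cv with
  | empty =>
    obtain ⟨h1, h2, h3, h4, h5⟩ := h
    exact ⟨cv, h1, h2, fun u v huv => h3 u v huv (by simp) (by simp), h4,
      fun e he v hv => h5 e he v hv (by simp)⟩
  | insert w W hw ih =>
    obtain ⟨h1, h2, h3, h4, h5⟩ := h
    set N := G.neighborSet w with hN
    have hF : (cv '' N ∪ (fun x => ce s(w, x)) '' N).ncard ≤ 8 := by
      have a1 := Set.ncard_union_le (cv '' N) ((fun x => ce s(w, x)) '' N)
      have a2 := Set.ncard_image_le (f := cv) N.toFinite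
      have a3 := Set.ncard_image_le (f := fun x => ce s(w, x)) N.toFinite
      have a4 : N.ncard ≤ 4 := hW w (by simp)
      omega
    obtain ⟨a, ha, haF⟩ : ∃ a ∈ (Lv w : Set ℕ), a ∉ cv '' N ∪ (fun x => ce s(w, x)) '' N := by
      apply Set.exists_mem_notMem_of_ncard_lt_ncard _ (Set.toFinite _)
      rw [Set.ncard_coe_finset]
      have := hLv w
      omega
    simp only [Set.mem_union, Set.mem_image, not_or, not_exists, not_and, hN,
      SimpleGraph.mem_neighborSet] at haF
    refine ih (cv := Function.update cv w a) (fun v hv => hW v (by simp [hv])) ⟨?_, h2, ?_, h4, ?_⟩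
    · intro v
      by_cases hv : v = w
      · subst hv; simpa using ha
      · simpa [hv] using h1 v
    · intro u v huv hu hv
      by_cases huw : u = w
      · subst huw
        simpa [huv.ne', eq_comm] using haF.1 v huv
      · by_cases hvw : v = w
        · subst hvw
          simpa [huw] using haF.1 u huv.symm
        · simpa [huw, hvw] using h3 u v huv (by simpa [huw] using hu) (by simpa [hvw] using hv)
    · intro e he v hv hvW
      by_cases hvw : v = w
      · subst hvw
        obtain ⟨x, rfl⟩ := Sym2.mem_iff_exists.1 hv
        simpa using haF.2 x he
      · simpa [hvw] using h5 e he v hv (by simpa [hvw] using hvW)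

/-- The colors which an edge `e` of `G` cannot receive when a total coloring of the graph `G`
without the edges in `C` is extended, after erasing the colors of all vertices of degree
at most `4`. -/
def forbiddenColors (G : SimpleGraph V) (C : Set (Sym2 V)) (cv : V → ℕ) (ce : Sym2 V → ℕ)
    (e : Sym2 V) : Set ℕ :=
  {a | (∃ v ∈ e, 4 < (G.neighborSet v).ncard ∧ cv v = a) ∨
    ∃ f ∈ (G.deleteEdges C).edgeSet, (∃ v, v ∈ e ∧ v ∈ f) ∧ ce f = a}

theorem IsProperTotalListColoring.exists_of_deleteEdges_s6 [Finite V] {G : SimpleGraph V}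
    {C : Set (Sym2 V)} {cv : V → ℕ} {ce : Sym2 V → ℕ}
    (h : IsProperTotalListColoring (G.deleteEdges C) Lv Le cv ce) (hLv : ∀ v, 9 ≤ (Lv v).card)
    (hC : ∀ e ∈ C, ∃ w ∈ e, (G.neighborSet w).ncard ≤ 4) (c : Sym2 V → ℕ)
    (hc : ∀ e ∈ C, c e ∈ Le e ∧ c e ∉ forbiddenColors G C cv ce e)
    (hcc : ∀ e ∈ C, ∀ f ∈ C, e ≠ f → (∃ v, v ∈ e ∧ v ∈ f) → c e ≠ c f) :
    ∃ cv' ce', IsProperTotalListColoring G Lv Le cv' ce' := by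
  classical
  obtain ⟨h1, h2, h3, h4, h5⟩ := h
  have hdel : ∀ e ∈ G.edgeSet, e ∉ C → e ∈ (G.deleteEdges C).edgeSet := fun e he heC => by
    rw [SimpleGraph.edgeSet_deleteEdges]
    exact ⟨he, heC⟩
  have hcross : ∀ e ∈ C, ∀ f ∈ G.edgeSet, f ∉ C → (∃ v, v ∈ e ∧ v ∈ f) → c e ≠ ce f :=
    fun e he f hf hfC hef heq => (hc e he).2 (Or.inr ⟨f, hdel f hf hfC, hef, heq.symm⟩)
  have := Fintype.ofFinite V
  let W : Finset V := {w | (G.neighborSet w).ncard ≤ 4}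
  have hW : ∀ w, w ∈ W ↔ (G.neighborSet w).ncard ≤ 4 := fun w => by simp [W]
  obtain ⟨cv', h'⟩ := IsProperTotalListColoringOff.exists_isProperTotalListColoring
    (Le := Le) (G := G) W (cv := cv) (ce := fun e => if e ∈ C then c e else ce e)
    (fun w hw => (hW w).1 hw) hLv <| by
    refine ⟨h1, ?_, ?_, ?_, ?_⟩
    · intro e he
      by_cases heC : e ∈ C
      · simpa [heC] using (hc e heC).1
      · simpa [heC] using h2 e (hdel e he heC)
    · intro u v huv hu hv
      refine h3 u v (hdel s(u, v) huv fun huvC => ?_)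
      obtain ⟨w, hw, hw4⟩ := hC _ huvC
      rcases Sym2.mem_iff.1 hw with rfl | rfl
      · exact hu ((hW _).2 hw4)
      · exact hv ((hW _).2 hw4)
    · intro e he f hf hne hef
      by_cases heC : e ∈ C <;> by_cases hfC : f ∈ C
      · simpa [heC, hfC] using hcc e heC f hfC hne hef
      · simpa [heC, hfC] using hcross e heC f hf hfC hef
      · simpa [heC, hfC] using
          (hcross f hfC e he heC (hef.imp fun _ => And.symm)).symm
      · simpa [heC, hfC] using h4 e (hdel e he heC) f (hdel f hf hfC) hne hef
    · intro e he v hv hvW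
      by_cases heC : e ∈ C
      · simp only [heC, if_true]
        exact fun heq => (hc e heC).2
          (Or.inl ⟨v, hv, not_le.1 fun h => hvW ((hW v).2 h), heq.symm⟩)
      · simpa [heC] using h5 e (hdel e he heC) v hv
  exact ⟨cv', _, h'⟩

theorem finite_forbiddenColors [Finite V] (G : SimpleGraph V) (C : Set (Sym2 V)) (cv : V → ℕ)
    (ce : Sym2 V → ℕ) (e : Sym2 V) : (forbiddenColors G C cv ce e).Finite := by
  refine ((Set.finite_range cv).union (Set.finite_range ce)).subset ?_
  rintro a (⟨v, -, -, rfl⟩ | ⟨f, -, -, rfl⟩)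
  · exact Or.inl ⟨v, rfl⟩
  · exact Or.inr ⟨f, rfl⟩

theorem ncard_forbiddenColors_le [Finite V] {G : SimpleGraph V} {C : Set (Sym2 V)} (cv : V → ℕ)
    (ce : Sym2 V → ℕ) {w : V} (v : V) (hw : (G.neighborSet w).ncard ≤ 4) :
    (forbiddenColors G C cv ce s(w, v)).ncard ≤
      1 + ((G.deleteEdges C).neighborSet w).ncard + ((G.deleteEdges C).neighborSet v).ncard := by
  set H := G.deleteEdges C
  have hsub : forbiddenColors G C cv ce s(w, v) ⊆
      {cv v} ∪ (fun x => ce s(w, x)) '' H.neighborSet w ∪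
        (fun x => ce s(v, x)) '' H.neighborSet v := by
    rintro a (⟨u, hu, hu4, rfl⟩ | ⟨f, hf, ⟨u, hu, huf⟩, rfl⟩)
    · rcases Sym2.mem_iff.1 hu with rfl | rfl
      · omega
      · simp
    · obtain ⟨x, rfl⟩ := Sym2.mem_iff_exists.1 huf
      rcases Sym2.mem_iff.1 hu with rfl | rfl
      · exact Or.inl (Or.inr ⟨x, hf, rfl⟩)
      · exact Or.inr ⟨x, hf, rfl⟩
  have a0 := Set.ncard_le_ncard hsub (by toFinite_tac)
  have a1 := Set.ncard_union_le ({cv v} ∪ (fun x => ce s(w, x)) '' H.neighborSet w)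
    ((fun x => ce s(v, x)) '' H.neighborSet v)
  have a2 := Set.ncard_union_le {cv v} ((fun x => ce s(w, x)) '' H.neighborSet w)
  have a3 := Set.ncard_image_le (f := fun x => ce s(w, x)) (H.neighborSet w).toFinite
  have a4 := Set.ncard_image_le (f := fun x => ce s(v, x)) (H.neighborSet v).toFinite
  rw [Set.ncard_singleton] at a2
  omega

/-- The edges of an even cycle can be colored from lists of size at least `2`. -/
theorem SimpleGraph.Walk.IsCycle.exists_listColoring_edges {G : SimpleGraph V} {x : V}
    {p : G.Walk x x} (hp : p.IsCycle) (heven : Even p.length) (L : Sym2 V → Finset ℕ)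
    (hL : ∀ e ∈ p.edges, 2 ≤ (L e).card) :
    ∃ c : Sym2 V → ℕ, (∀ e ∈ p.edges, c e ∈ L e) ∧
      ∀ e ∈ p.edges, ∀ f ∈ p.edges, e ≠ f → (∃ v, v ∈ e ∧ v ∈ f) → c e ≠ c f := by
  classical
  have h3 := hp.three_le_length
  let E : ℕ → Sym2 V := fun i => s(p.getVert i, p.getVert (i + 1))
  have hE : ∀ e, e ∈ p.edges ↔ ∃ i < p.length, E i = e := by
    intro e
    rw [List.mem_iff_getElem]
    simp [E, SimpleGraph.Walk.getElem_edges]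
  obtain ⟨c, hc1, hc2, hc3⟩ := exists_even_cycle_listColoring p.length heven (by omega)
    (fun i => L (E i)) (fun i hi => hL _ ((hE _).2 ⟨i, hi, rfl⟩))
  have hEinj : ∀ i < p.length, ∀ j < p.length, E i = E j → i = j := by
    intro i hi j hj hij
    have := (List.nodup_iff_injective_getElem.1 hp.edges_nodup)
      (a₁ := ⟨i, by simpa using hi⟩) (a₂ := ⟨j, by simpa using hj⟩)
      (by simpa [E, SimpleGraph.Walk.getElem_edges] using hij)
    simpa using this
  have hinj : ∀ i < p.length, ∀ j < p.length, p.getVert i = p.getVert j → i = j :=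
    fun i hi j hj h => hp.getVert_injOn' (by simp; omega) (by simp; omega) h
  have hinj' : ∀ i < p.length, ∀ j < p.length, p.getVert (i + 1) = p.getVert (j + 1) → i = j :=
    fun i hi j hj h => Nat.succ_injective (hp.getVert_injOn (by simp; omega) (by simp; omega) h)
  have hcons : ∀ i < p.length, ∀ j < p.length, p.getVert i = p.getVert (j + 1) → c i ≠ c j := by
    intro i hi j hj h
    rcases Nat.lt_or_ge (j + 1) p.length with hj' | hj'
    · rw [hinj i hi (j + 1) hj' h]
      exact (hc2 j hj').symm
    · obtain rfl : j = p.length - 1 := by omega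
      have : p.getVert (p.length - 1 + 1) = p.getVert 0 := by
        rw [Nat.sub_add_cancel (by omega)]; simp
      rw [hinj i hi 0 (by omega) (h.trans this)]
      exact hc3.symm
  have hex : ∀ e, ∃ a, ∀ i < p.length, E i = e → c i = a := by
    intro e
    by_cases he : ∃ i < p.length, E i = e
    · obtain ⟨i, hi, rfl⟩ := he
      exact ⟨c i, fun j hj hji => by rw [hEinj j hj i hi hji]⟩
    · exact ⟨0, fun i hi h => absurd ⟨i, hi, h⟩ he⟩
  choose d hd using hex
  refine ⟨d, fun e he => ?_, fun e he f hf hne hef => ?_⟩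
  · obtain ⟨i, hi, rfl⟩ := (hE e).1 he
    rw [← hd _ i hi rfl]
    exact hc1 i hi
  · obtain ⟨i, hi, rfl⟩ := (hE e).1 he
    obtain ⟨j, hj, rfl⟩ := (hE f).1 hf
    rw [← hd _ i hi rfl, ← hd _ j hj rfl]
    obtain ⟨v, hvi, hvj⟩ := hef
    rcases Sym2.mem_iff.1 hvi with h | h <;> rcases Sym2.mem_iff.1 hvj with h' | h'
    · exact absurd (congrArg E (hinj i hi j hj (h.symm.trans h'))) hne
    · exact hcons i hi j hj (h.symm.trans h')
    · exact (hcons j hj i hi (h'.symm.trans h)).symm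
    · exact absurd (congrArg E (hinj' i hi j hj (h.symm.trans h'))) hne

/-- A vertex on a cycle loses exactly two neighbors when the edges of the cycle are deleted. -/
theorem SimpleGraph.Walk.IsCycle.ncard_neighborSet_deleteEdges [Finite V] {G : SimpleGraph V}
    {x v : V} {p : G.Walk x x} (hp : p.IsCycle) (hv : v ∈ p.support) :
    ((G.deleteEdges {e | e ∈ p.edges}).neighborSet v).ncard + 2 = (G.neighborSet v).ncard := by
  have h2 := hp.ncard_neighborSet_toSubgraph_eq_two hv
  have hsub := p.toSubgraph.neighborSet_subset v
  have : (G.deleteEdges {e | e ∈ p.edges}).neighborSet v =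
      G.neighborSet v \ p.toSubgraph.neighborSet v := by
    ext u
    simp [SimpleGraph.deleteEdges_adj, SimpleGraph.Walk.adj_toSubgraph_iff_mem_edges]
  rw [this, ← h2, Set.ncard_sdiff_add_ncard_of_subset hsub]

end TotalColoring

/-- Let `G` be a finite simple graph, `k ≥ 9`, with maximum degree at
most `k - 1`.  Suppose every subgraph `H` of `G` containing an edge either (i) has an
edge `uv` with `d_H(u) ≤ 4` and `d_H(u) + d_H(v) ≤ k`, or (ii) contains a 2-alternating
cycle, i.e. a cycle of even length `2m ≥ 4` whose odd-position vertices all have degree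
exactly 2 in `H`.  Then `G` is `k`-total-choosable. -/
theorem stmt_6 {V : Type*} [Fintype V] (G : SimpleGraph V) [DecidableRel G.Adj]
    (k : ℕ) (hk : 9 ≤ k) (hΔ : G.maxDegree ≤ k - 1)
    (hsub : ∀ H : G.Subgraph, H.edgeSet.Nonempty →
      (∃ u v, H.Adj u v ∧ (H.neighborSet u).ncard ≤ 4 ∧
        (H.neighborSet u).ncard + (H.neighborSet v).ncard ≤ k) ∨
      (∃ (x : V) (p : H.spanningCoe.Walk x x), p.IsCycle ∧ Even p.length ∧
        4 ≤ p.length ∧ ∀ (i : ℕ) (h : 2 * i + 1 < p.support.length),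
          (H.neighborSet (p.support.get ⟨2 * i + 1, h⟩)).ncard = 2))
    (Lv : V → Finset ℕ) (Le : Sym2 V → Finset ℕ)
    (hLv : ∀ v, k ≤ (Lv v).card) (hLe : ∀ e ∈ G.edgeSet, k ≤ (Le e).card) :
    ∃ cv ce, IsProperTotalListColoring G Lv Le cv ce := by
  classical
  have hLv9 : ∀ v, 9 ≤ (Lv v).card := fun v => hk.trans (hLv v)
  suffices key : ∀ (n : ℕ) (H : SimpleGraph V), H ≤ G → H.edgeSet.ncard = n →
      ∃ cv ce, IsProperTotalListColoring H Lv Le cv ce from key _ G le_rfl rfl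
  intro n
  induction n using Nat.strong_induction_on with
  | _ n ih =>
  rintro H hHG rfl
  have hsmall : ∀ C : Set (Sym2 V), (∃ e ∈ C, e ∈ H.edgeSet) →
      ∃ cv ce, IsProperTotalListColoring (H.deleteEdges C) Lv Le cv ce := by
    rintro C ⟨e, heC, he⟩
    refine ih _ ?_ (H.deleteEdges C) ((H.deleteEdges_le C).trans hHG) rfl
    apply Set.ncard_lt_ncard _ (Set.toFinite _)
    rw [SimpleGraph.edgeSet_deleteEdges]
    exact ⟨Set.sdiff_subset, fun h => (h he).2 heC⟩
  rcases H.edgeSet.eq_empty_or_nonempty with hempty | hne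
  · have hchoose : ∀ v, ∃ a, a ∈ Lv v := fun v =>
      Finset.card_pos.1 (by have := hLv9 v; omega)
    choose cv hcv using hchoose
    have hnot : ∀ e, e ∉ H.edgeSet := fun e => by simp [hempty]
    exact ⟨cv, fun _ => 0, hcv, fun e he => absurd he (hnot e),
      fun u v huv => absurd huv (hnot s(u, v)), fun e he => absurd he (hnot e),
      fun e he => absurd he (hnot e)⟩
  have hsub' : (∃ u v, H.Adj u v ∧ (H.neighborSet u).ncard ≤ 4 ∧
        (H.neighborSet u).ncard + (H.neighborSet v).ncard ≤ k) ∨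
      ∃ (x : V) (p : H.Walk x x), p.IsCycle ∧ Even p.length ∧
        ∀ i, 2 * i + 1 ≤ p.length → (H.neighborSet (p.getVert (2 * i + 1))).ncard = 2 :=
    (hsub (SimpleGraph.toSubgraph H hHG) hne).imp_right
      fun ⟨x, p, hp, heven, _, htwo⟩ => ⟨x, p, hp, heven, fun i hi =>
        p.support_getElem_eq_getVert (n := 2 * i + 1) _ ▸
          htwo i ((Nat.lt_succ_of_le hi).trans_eq p.length_support.symm)⟩
  rcases hsub' with ⟨u, v, huv, hu4, hsum⟩ | ⟨x, p, hp, heven, htwo⟩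
  · obtain ⟨cv, ce, hcol⟩ := hsmall {s(u, v)} ⟨_, rfl, huv⟩
    have hlt : ∀ a b, H.Adj a b → s(a, b) = s(u, v) →
        ((H.deleteEdges {s(u, v)}).neighborSet a).ncard < (H.neighborSet a).ncard := by
      intro a b hab hs
      refine Set.ncard_lt_ncard ⟨fun y hy => (H.deleteEdges_le _) hy, fun h => ?_⟩ (Set.toFinite _)
      have hb : (H.deleteEdges {s(u, v)}).Adj a b := h hab
      rw [SimpleGraph.deleteEdges_adj] at hb
      exact hb.2 hs
    have hforb := ncard_forbiddenColors_le (C := {s(u, v)}) cv ce v hu4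
    have hu := hlt u v huv rfl
    have hv := hlt v u huv.symm Sym2.eq_swap
    obtain ⟨a, ha, haF⟩ : ∃ a ∈ (Le s(u, v) : Set ℕ),
        a ∉ forbiddenColors H {s(u, v)} cv ce s(u, v) := by
      apply Set.exists_mem_notMem_of_ncard_lt_ncard _ (finite_forbiddenColors _ _ _ _ _)
      rw [Set.ncard_coe_finset]
      have := hLe s(u, v) (hHG huv)
      omega
    refine hcol.exists_of_deleteEdges_s6 hLv9 ?_ (fun _ => a) ?_ ?_
    · rintro e rfl
      exact ⟨u, by simp, hu4⟩
    · rintro e rfl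
      exact ⟨ha, haF⟩
    · rintro e rfl f rfl hef
      exact absurd rfl hef
  · have h3 := hp.three_le_length
    set C : Set (Sym2 V) := {e | e ∈ p.edges} with hC
    have hform : ∀ e ∈ C, ∃ w v, e = s(w, v) ∧ w ∈ p.support ∧ v ∈ p.support ∧
        (H.neighborSet w).ncard = 2 := by
      intro e he
      obtain ⟨i, hi, rfl⟩ := List.mem_iff_getElem.1 he
      rw [SimpleGraph.Walk.length_edges] at hi
      rw [SimpleGraph.Walk.getElem_edges]
      obtain ⟨j, rfl | rfl⟩ := Nat.even_or_odd' i
      · exact ⟨_, _, Sym2.eq_swap, p.getVert_mem_support _, p.getVert_mem_support _,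
          htwo j (by omega)⟩
      · exact ⟨_, _, rfl, p.getVert_mem_support _, p.getVert_mem_support _, htwo j (by omega)⟩
    obtain ⟨cv, ce, hcol⟩ := hsmall C ⟨s(p.getVert 0, p.getVert 1),
      List.mem_iff_getElem.2 ⟨0, by simp; omega, SimpleGraph.Walk.getElem_edges ..⟩,
      p.adj_getVert_succ (by omega)⟩
    have hdeg : ∀ v, (H.neighborSet v).ncard ≤ k - 1 := by
      intro v
      calc (H.neighborSet v).ncard ≤ (G.neighborSet v).ncard :=
            Set.ncard_le_ncard (fun y hy => hHG hy) (Set.toFinite _)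
        _ = G.degree v := by
            rw [Set.ncard_eq_toFinset_card', ← SimpleGraph.card_neighborFinset_eq_degree]; rfl
        _ ≤ k - 1 := (G.degree_le_maxDegree v).trans hΔ
    let L : Sym2 V → Finset ℕ := fun e =>
      Le e \ (finite_forbiddenColors H C cv ce e).toFinset
    obtain ⟨c, hcL, hcc⟩ := hp.exists_listColoring_edges heven L <| by
      intro e he
      have heG : e ∈ G.edgeSet := SimpleGraph.edgeSet_mono hHG (p.edges_subset_edgeSet he)
      obtain ⟨w, v, rfl, hw, hv, hw2⟩ := hform e he
      have hforb := ncard_forbiddenColors_le (C := C) cv ce v (hw2.le.trans (by norm_num))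
      have hw' := hp.ncard_neighborSet_deleteEdges hw
      have hv' := hp.ncard_neighborSet_deleteEdges hv
      rw [← hC] at hw' hv'
      have h1 := Finset.le_card_sdiff (finite_forbiddenColors H C cv ce s(w, v)).toFinset
        (Le s(w, v))
      rw [← Set.ncard_eq_toFinset_card _ (finite_forbiddenColors H C cv ce s(w, v))] at h1
      have h2 := hLe _ heG
      have h3 := hdeg v
      change 2 ≤ (Le s(w, v) \ (finite_forbiddenColors H C cv ce s(w, v)).toFinset).card
      omega
    refine hcol.exists_of_deleteEdges_s6 hLv9 ?_ c ?_ hcc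
    · intro e he
      obtain ⟨w, v, rfl, -, -, hw2⟩ := hform e he
      exact ⟨w, by simp, by omega⟩
    · intro e he
      simpa [L] using hcL e he
end

section
/- Let G₀ be the simple graph on the eight vertices u, x₁, x₂, y₁, y₂, z₁, z₂, w whose edge set consists of the ten edges ux₁, x₁x₂, x₂u, uy₁, y₁y₂, y₂u, uz₁, z₁z₂, z₂u, x₂w (three triangles through u, together with a pendant edge at x₂). Let L assign to each edge a finite set of colors with |L(ux₁)| ≥ 3, |L(x₁x₂)| ≥ 3, |L(x₂u)| ≥ 7, |L(uy₁)| ≥ 3, |L(y₁y₂)| ≥ 2, |L(y₂u)| ≥ 6, |L(uz₁)| ≥ 3, |L(z₁z₂)| ≥ 1, |L(z₂u)| ≥ 5, and |L(x₂w)| ≥ 2. Then G₀ has a proper edge coloring choosing each edge's color from its list (distinct edges sharing an endpoint receive different colors). -/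
/-- The graph `G₀` on eight vertices `u = 0`, `x₁ = 1`, `x₂ = 2`, `y₁ = 3`, `y₂ = 4`,
`z₁ = 5`, `z₂ = 6`, `w = 7`: three triangles `u x₁ x₂`, `u y₁ y₂`, `u z₁ z₂` through
`u`, together with the pendant edge `x₂ w`. -/
def G₀ : SimpleGraph (Fin 8) :=
  SimpleGraph.fromEdgeSet
    {s(0, 1), s(1, 2), s(2, 0), s(0, 3), s(3, 4), s(4, 0), s(0, 5), s(5, 6), s(6, 0),
      s(2, 7)}

/-- A finite set has an element outside any shorter list. -/
theorem exists_mem_notMem_of_length_lt {S : Finset ℕ} (l : List ℕ) (h : l.length < S.card) :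
    ∃ x ∈ S, x ∉ l := by
  obtain ⟨x, hx, hxl⟩ := Finset.exists_mem_notMem_of_card_lt_card
    ((List.toFinset_card_le l).trans_lt h)
  exact ⟨x, hx, by simpa using hxl⟩

/-- A finite set has an element outside a list of the same length that takes some value
outside the set. -/
theorem exists_mem_notMem_of_length_le {S : Finset ℕ} {l : List ℕ} {γ : ℕ} (hγ : γ ∈ l)
    (hS : γ ∉ S) (h : l.length ≤ S.card) : ∃ x ∈ S, x ∉ l := by
  have hlt : (l.erase γ).length < S.card := by
    have := List.length_pos_of_mem hγ
    rw [List.length_erase_of_mem hγ]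
    omega
  obtain ⟨x, hx, hxl⟩ := exists_mem_notMem_of_length_lt _ hlt
  have hne : x ≠ γ := fun h => hS (h ▸ hx)
  exact ⟨x, hx, fun h => hxl ((List.mem_erase_of_ne hne).2 h)⟩

/-- Five edges at `u` together with an edge `e` meeting `d` and `f` can be colored from their
lists so that a prescribed color of the list of `f` occurs at `u`. -/
theorem exists_coloring_using {A D G I E F : Finset ℕ} {γ : ℕ} (hA : 3 ≤ A.card)
    (hD : 3 ≤ D.card) (hG : 2 ≤ G.card) (hI : 4 ≤ I.card) (hE : 2 ≤ E.card)
    (hF : 6 ≤ F.card) (hγ : γ ∈ F) :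
    ∃ a ∈ A, ∃ d ∈ D, ∃ g ∈ G, ∃ i ∈ I, ∃ e ∈ E, ∃ f ∈ F,
      [a, d, g, i, f].Nodup ∧ e ≠ d ∧ e ≠ f ∧ γ ∈ [a, d, g, i, f] := by
  by_cases hγA : γ ∈ A
  · obtain ⟨g, hg, hg'⟩ := exists_mem_notMem_of_length_lt (S := G) [γ] (by simp; omega)
    obtain ⟨d, hd, hd'⟩ := exists_mem_notMem_of_length_lt (S := D) [γ, g] (by simp; omega)
    obtain ⟨i, hi, hi'⟩ := exists_mem_notMem_of_length_lt (S := I) [γ, d, g] (by simp; omega)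
    obtain ⟨e, he, he'⟩ := exists_mem_notMem_of_length_lt (S := E) [d] (by simp; omega)
    obtain ⟨f, hf, hf'⟩ :=
      exists_mem_notMem_of_length_lt (S := F) [γ, d, g, i, e] (by simp; omega)
    exact ⟨γ, hγA, d, hd, g, hg, i, hi, e, he, f, hf, by grind⟩
  by_cases hγD : γ ∈ D
  · obtain ⟨g, hg, hg'⟩ := exists_mem_notMem_of_length_lt (S := G) [γ] (by simp; omega)
    obtain ⟨a, ha, ha'⟩ := exists_mem_notMem_of_length_lt (S := A) [γ, g] (by simp; omega)
    obtain ⟨i, hi, hi'⟩ := exists_mem_notMem_of_length_lt (S := I) [γ, a, g] (by simp; omega)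
    obtain ⟨e, he, he'⟩ := exists_mem_notMem_of_length_lt (S := E) [γ] (by simp; omega)
    obtain ⟨f, hf, hf'⟩ :=
      exists_mem_notMem_of_length_lt (S := F) [γ, a, g, i, e] (by simp; omega)
    exact ⟨a, ha, γ, hγD, g, hg, i, hi, e, he, f, hf, by grind⟩
  by_cases hγG : γ ∈ G
  · obtain ⟨a, ha, ha'⟩ := exists_mem_notMem_of_length_lt (S := A) [γ] (by simp; omega)
    obtain ⟨d, hd, hd'⟩ := exists_mem_notMem_of_length_lt (S := D) [γ, a] (by simp; omega)
    obtain ⟨i, hi, hi'⟩ := exists_mem_notMem_of_length_lt (S := I) [γ, a, d] (by simp; omega)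
    obtain ⟨e, he, he'⟩ := exists_mem_notMem_of_length_lt (S := E) [d] (by simp; omega)
    obtain ⟨f, hf, hf'⟩ :=
      exists_mem_notMem_of_length_lt (S := F) [γ, a, d, i, e] (by simp; omega)
    exact ⟨a, ha, d, hd, γ, hγG, i, hi, e, he, f, hf, by grind⟩
  by_cases hγI : γ ∈ I
  · obtain ⟨g, hg⟩ := Finset.card_pos.1 (show 0 < G.card by omega)
    obtain ⟨a, ha, ha'⟩ := exists_mem_notMem_of_length_lt (S := A) [g] (by simp; omega)
    obtain ⟨d, hd, hd'⟩ := exists_mem_notMem_of_length_lt (S := D) [g, a] (by simp; omega)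
    obtain ⟨e, he, he'⟩ := exists_mem_notMem_of_length_lt (S := E) [d] (by simp; omega)
    obtain ⟨f, hf, hf'⟩ :=
      exists_mem_notMem_of_length_lt (S := F) [γ, a, d, g, e] (by simp; omega)
    exact ⟨a, ha, d, hd, g, hg, γ, hγI, e, he, f, hf, by grind⟩
  · obtain ⟨e, he, he'⟩ := exists_mem_notMem_of_length_lt (S := E) [γ] (by simp; omega)
    obtain ⟨d, hd, hd'⟩ := exists_mem_notMem_of_length_lt (S := D) [e] (by simp; omega)
    obtain ⟨g, hg, hg'⟩ := exists_mem_notMem_of_length_lt (S := G) [d] (by simp; omega)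
    obtain ⟨a, ha, ha'⟩ := exists_mem_notMem_of_length_lt (S := A) [d, g] (by simp; omega)
    obtain ⟨i, hi, hi'⟩ := exists_mem_notMem_of_length_lt (S := I) [a, d, g] (by simp; omega)
    exact ⟨a, ha, d, hd, g, hg, i, hi, e, he, γ, hγ, by grind⟩

/-- The coloring problem on the nine edges other than `z₁z₂`, whose color is already removed
from the lists `G` and `I` of the edges meeting it. -/
theorem exists_coloring_of_card_le {A B C D E F G I W : Finset ℕ} (hA : 3 ≤ A.card)
    (hB : 3 ≤ B.card) (hC : 7 ≤ C.card) (hD : 3 ≤ D.card) (hE : 2 ≤ E.card)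
    (hF : 6 ≤ F.card) (hG : 2 ≤ G.card) (hI : 4 ≤ I.card) (hW : 2 ≤ W.card) :
    ∃ a ∈ A, ∃ b ∈ B, ∃ c ∈ C, ∃ d ∈ D, ∃ e ∈ E, ∃ f ∈ F, ∃ g ∈ G, ∃ i ∈ I, ∃ w ∈ W,
      [a, d, g, i, f].Nodup ∧ e ≠ d ∧ e ≠ f ∧ b ≠ a ∧ b ≠ w ∧ c ∉ [a, d, g, i, f, b, w] := by
  by_cases hWC : W ⊆ C
  · by_cases hγ : ∃ γ ∈ F, γ ∈ W ∨ γ ∉ C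
    · obtain ⟨γ, hγF, hγ⟩ := hγ
      obtain ⟨a, ha, d, hd, g, hg, i, hi, e, he, f, hf, hnd, hed, hef, hmem⟩ :=
        exists_coloring_using hA hD hG hI hE hF hγF
      rcases hγ with hγW | hγC
      · obtain ⟨b, hb, hb'⟩ := exists_mem_notMem_of_length_lt (S := B) [a, γ] (by simp; omega)
        obtain ⟨c, hc, hc'⟩ :=
          exists_mem_notMem_of_length_lt (S := C) [a, d, g, i, f, b] (by simp; omega)
        exact ⟨a, ha, b, hb, c, hc, d, hd, e, he, f, hf, g, hg, i, hi, γ, hγW, by grind⟩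
      · obtain ⟨b, hb, hb'⟩ := exists_mem_notMem_of_length_lt (S := B) [a] (by simp; omega)
        obtain ⟨w, hw, hw'⟩ := exists_mem_notMem_of_length_lt (S := W) [b] (by simp; omega)
        obtain ⟨c, hc, hc'⟩ := exists_mem_notMem_of_length_le
          (S := C) (l := [a, d, g, i, f, b, w]) (by grind) hγC (by simpa using hC)
        exact ⟨a, ha, b, hb, c, hc, d, hd, e, he, f, hf, g, hg, i, hi, w, hw, by grind⟩
    · push Not at hγ
      have hcard : 8 ≤ C.card := by
        have hdisj : Disjoint F W := Finset.disjoint_left.2 fun x hx => (hγ x hx).1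
        have := Finset.card_le_card (Finset.union_subset (fun x hx => (hγ x hx).2) hWC)
        rw [Finset.card_union_of_disjoint hdisj] at this
        omega
      obtain ⟨γ, hγF⟩ := Finset.card_pos.1 (show 0 < F.card by omega)
      obtain ⟨a, ha, d, hd, g, hg, i, hi, e, he, f, hf, hnd, hed, hef, -⟩ :=
        exists_coloring_using hA hD hG hI hE hF hγF
      obtain ⟨b, hb, hb'⟩ := exists_mem_notMem_of_length_lt (S := B) [a] (by simp; omega)
      obtain ⟨w, hw, hw'⟩ := exists_mem_notMem_of_length_lt (S := W) [b] (by simp; omega)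
      obtain ⟨c, hc, hc'⟩ :=
        exists_mem_notMem_of_length_lt (S := C) [a, d, g, i, f, b, w] (by simp; omega)
      exact ⟨a, ha, b, hb, c, hc, d, hd, e, he, f, hf, g, hg, i, hi, w, hw, by grind⟩
  · obtain ⟨w, hw, hwC⟩ := Finset.not_subset.1 hWC
    obtain ⟨γ, hγF⟩ := Finset.card_pos.1 (show 0 < F.card by omega)
    obtain ⟨a, ha, d, hd, g, hg, i, hi, e, he, f, hf, hnd, hed, hef, -⟩ :=
      exists_coloring_using hA hD hG hI hE hF hγF
    obtain ⟨b, hb, hb'⟩ := exists_mem_notMem_of_length_lt (S := B) [a, w] (by simp; omega)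
    obtain ⟨c, hc, hc'⟩ := exists_mem_notMem_of_length_le
      (S := C) (l := [a, d, g, i, f, b, w]) (by simp) hwC (by simpa using hC)
    exact ⟨a, ha, b, hb, c, hc, d, hd, e, he, f, hf, g, hg, i, hi, w, hw, by grind⟩

/-- If a list assignment `L` on the edges of `G₀` satisfies
`|L(ux₁)| ≥ 3`, `|L(x₁x₂)| ≥ 3`, `|L(x₂u)| ≥ 7`, `|L(uy₁)| ≥ 3`, `|L(y₁y₂)| ≥ 2`,
`|L(y₂u)| ≥ 6`, `|L(uz₁)| ≥ 3`, `|L(z₁z₂)| ≥ 1`, `|L(z₂u)| ≥ 5`, `|L(x₂w)| ≥ 2`, then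
`G₀` has a proper edge coloring from the lists `L`. -/
theorem stmt_7 (L : Sym2 (Fin 8) → Finset ℕ)
    (h1 : 3 ≤ (L s(0, 1)).card) (h2 : 3 ≤ (L s(1, 2)).card)
    (h3 : 7 ≤ (L s(2, 0)).card) (h4 : 3 ≤ (L s(0, 3)).card)
    (h5 : 2 ≤ (L s(3, 4)).card) (h6 : 6 ≤ (L s(4, 0)).card)
    (h7 : 3 ≤ (L s(0, 5)).card) (h8 : 1 ≤ (L s(5, 6)).card)
    (h9 : 5 ≤ (L s(6, 0)).card) (h10 : 2 ≤ (L s(2, 7)).card) :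
    ∃ c, IsProperEdgeListColoring G₀ L c := by
  obtain ⟨h, hh⟩ := Finset.card_pos.1 (show 0 < (L s(5, 6)).card by omega)
  obtain ⟨a, ha, b, hb, c, hc, d, hd, e, he, f, hf, g, hg, i, hi, w, hw, hnd, hed, hef, hba, hbw,
      hcl⟩ :=
    exists_coloring_of_card_le h1 h2 h3 h4 h5 h6
      (G := (L s(0, 5)).erase h) (I := (L s(6, 0)).erase h)
      (by have := Finset.pred_card_le_card_erase (s := L s(0, 5)) (a := h); omega)
      (by have := Finset.pred_card_le_card_erase (s := L s(6, 0)) (a := h); omega) h10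
  obtain ⟨hgh, hg⟩ := Finset.mem_erase.1 hg
  obtain ⟨hih, hi⟩ := Finset.mem_erase.1 hi
  simp only [List.nodup_cons, List.mem_cons, List.not_mem_nil, not_or, or_false] at hnd hcl
  let col : Sym2 (Fin 8) → ℕ := fun x =>
    if x = s(0, 1) then a else if x = s(1, 2) then b else if x = s(2, 0) then c
    else if x = s(0, 3) then d else if x = s(3, 4) then e else if x = s(4, 0) then f
    else if x = s(0, 5) then g else if x = s(5, 6) then h else if x = s(6, 0) then i else w
  have edges : ∀ x ∈ G₀.edgeSet, x = s(0, 1) ∨ x = s(1, 2) ∨ x = s(2, 0) ∨ x = s(0, 3) ∨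
      x = s(3, 4) ∨ x = s(4, 0) ∨ x = s(0, 5) ∨ x = s(5, 6) ∨ x = s(6, 0) ∨ x = s(2, 7) := by
    intro x hx
    rw [G₀, SimpleGraph.edgeSet_fromEdgeSet] at hx
    exact hx.1
  refine ⟨col, fun x hx => ?_, fun x hx y hy hxy hv => ?_⟩
  · rcases edges x hx with
      rfl | rfl | rfl | rfl | rfl | rfl | rfl | rfl | rfl | rfl <;> simpa [col]
  · rcases edges x hx with
      rfl | rfl | rfl | rfl | rfl | rfl | rfl | rfl | rfl | rfl <;>
    rcases edges y hy with
      rfl | rfl | rfl | rfl | rfl | rfl | rfl | rfl | rfl | rfl <;>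
    first
    | exact absurd rfl hxy
    | exact absurd hv (by decide)
    | (simp only [col, Sym2.eq_iff, Fin.reduceEq, and_self, and_false, and_true, or_self,
        if_true, if_false]; grind)
end

section
/- Let G be a finite simple graph, let L assign a finite set of colors to each edge of G, and let C be a cycle of even length in G. Suppose that for each edge e of C, |L(e)| is at least 2 plus the number of edges of G not belonging to C that share an endpoint with e. If the graph G − E(C) obtained by deleting the edges of C admits a proper edge coloring from the lists L, then G admits a proper edge coloring from the lists L. -/
/-- Even cycles are 2-choosable: lists of size at least two on the cyclic group of even order
admit a choice in which cyclically consecutive elements get distinct colors. -/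
theorem exists_choice_ne_succ_of_even {n : ℕ} [NeZero n] (hn : Even n)
    (L : ZMod n → Finset ℕ) (hL : ∀ i, 2 ≤ (L i).card) :
    ∃ f : ZMod n → ℕ, ∀ i, f i ∈ L i ∧ f i ≠ f (i + 1) := by
  have hval (j : ZMod n) :
      (j.val + 1 < n ∧ (j + 1).val = j.val + 1) ∨ (j.val + 1 = n ∧ (j + 1).val = 0) := by
    have h1 : (j + 1).val = (j.val + 1) % n := by
      conv_lhs => rw [← ZMod.natCast_zmod_val j, ← Nat.cast_succ, ZMod.val_natCast]
    rcases (Nat.succ_le_of_lt (ZMod.val_lt j)).lt_or_eq with h | h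
    · exact Or.inl ⟨h, h1.trans (Nat.mod_eq_of_lt h)⟩
    · exact Or.inr ⟨h, by rw [h1, ← Nat.succ_eq_add_one, h, Nat.mod_self]⟩
  by_cases hsub : ∀ i, L (i + 1) ⊆ L i
  · have hall : ∀ k : ℕ, ∀ i : ZMod n, L (i + k) ⊆ L i := by
      intro k
      induction k with
      | zero => intro i; simp
      | succ k ih =>
        intro i
        rw [Nat.cast_succ, ← add_assoc]
        exact (hsub _).trans (ih i)
    obtain ⟨a, ha, b, hb, hab⟩ := Finset.one_lt_card.mp (hL 0)
    have hzero (i : ZMod n) : L 0 ⊆ L i := by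
      have h := hall (-i).val i
      rwa [ZMod.natCast_zmod_val, add_neg_cancel] at h
    refine ⟨fun j => if Even j.val then a else b, fun i => ⟨?_, ?_⟩⟩
    · dsimp only
      split_ifs
      exacts [hzero i ha, hzero i hb]
    · have hpar : Even (i + 1).val ↔ ¬ Even i.val := by
        rcases hval i with ⟨-, h⟩ | ⟨h, h'⟩
        · rw [h, Nat.even_add_one]
        · rw [h', ← Nat.even_add_one, h]
          simp [hn]
      by_cases he : Even i.val
      · simp [hpar, he, hab]
      · simp [hpar, he, hab.symm]
  · push Not at hsub
    obtain ⟨i, hi⟩ := hsub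
    obtain ⟨a, ha, ha'⟩ := Finset.not_subset.mp hi
    have hnext (j : ZMod n) (x : ℕ) : ∃ y ∈ L j, y ≠ x :=
      Finset.exists_mem_ne (hL j) x
    choose next hmem hne using hnext
    let g : ℕ → ℕ := fun k => Nat.rec a (fun k x => next (i + 1 + (k + 1 : ℕ)) x) k
    have hg (k : ℕ) : g k ∈ L (i + 1 + k) := by
      cases k with
      | zero => simpa [g] using ha
      | succ k => exact hmem _ _
    have hgs (k : ℕ) : g (k + 1) ≠ g k := hne _ _
    have hmemL (j : ZMod n) : g (j - (i + 1)).val ∈ L j := by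
      simpa using hg (j - (i + 1)).val
    refine ⟨fun j => g (j - (i + 1)).val, fun j => ⟨hmemL j, ?_⟩⟩
    have hj : j + 1 - (i + 1) = j - (i + 1) + 1 := by ring
    dsimp only
    rw [hj]
    rcases hval (j - (i + 1)) with ⟨-, h⟩ | ⟨-, h⟩
    · rw [h]
      exact (hgs _).symm
    · rw [h]
      have hji : j = i := by
        have h0 := (ZMod.val_eq_zero _).mp h
        rw [← hj, sub_eq_zero] at h0
        exact add_right_cancel h0
      intro heq
      apply ha'
      have h2 := hmemL j
      rw [heq] at h2
      rwa [hji] at h2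

/-- The vertices of a cycle, listed injectively by a cyclic group, with its edges joining
cyclically consecutive vertices. -/
theorem SimpleGraph.Walk.IsCycle.exists_zmod_parametrization {V : Type*} {G : SimpleGraph V}
    {x : V} {p : G.Walk x x} (hp : p.IsCycle) :
    ∃ u : ZMod p.length → V, Function.Injective u ∧
      ∀ e, e ∈ p.edges ↔ ∃ j, s(u j, u (j + 1)) = e := by
  have hlen := hp.three_le_length
  have : NeZero p.length := ⟨by omega⟩
  have hcast (k : ℕ) (hk : k ≤ p.length) :
      p.getVert (k : ZMod p.length).val = p.getVert k := by
    rw [ZMod.val_natCast]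
    rcases hk.lt_or_eq with h | h
    · rw [Nat.mod_eq_of_lt h]
    · rw [h, Nat.mod_self, p.getVert_zero, p.getVert_length]
  have hedge (k : ℕ) (hk : k < p.length) :
      s(p.getVert (k : ZMod p.length).val, p.getVert ((k : ZMod p.length) + 1).val) =
        p.edges[k]'(by simpa using hk) := by
    rw [← Nat.cast_succ, hcast k hk.le, hcast (k + 1) hk]
    simp [SimpleGraph.Walk.edges, SimpleGraph.Walk.darts_getElem_eq_getVert]
  refine ⟨fun j => p.getVert j.val, ?_, fun e => ?_⟩
  · intro j k hjk
    apply ZMod.val_injective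
    have hj := ZMod.val_lt j
    have hk := ZMod.val_lt k
    exact hp.getVert_injOn' (by simp; omega) (by simp; omega) hjk
  · constructor
    · intro he
      obtain ⟨k, hk, rfl⟩ := List.mem_iff_getElem.mp he
      exact ⟨k, hedge k (by simpa using hk)⟩
    · rintro ⟨j, rfl⟩
      have h := hedge j.val (ZMod.val_lt j)
      rw [ZMod.natCast_zmod_val] at h
      rw [h]
      exact List.getElem_mem _

/-- Let `G` be a finite simple graph, `L` a list assignment on its
edges, and `C` an even cycle in `G` (given as a closed walk `p` that is a cycle of even
length).  Suppose that each edge `e` of `C` has a list of size at least `2` plus the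
number of edges of `G` outside `C` sharing an endpoint with `e`.  If `G - E(C)` has a
proper edge coloring from the lists `L`, then so does `G`. -/
theorem stmt_8 {V : Type*} [Fintype V] (G : SimpleGraph V) (L : Sym2 V → Finset ℕ)
    (x : V) (p : G.Walk x x) (hp : p.IsCycle) (hev : Even p.length)
    (hL : ∀ e ∈ p.edges,
      2 + {f : Sym2 V | f ∈ G.edgeSet ∧ f ∉ p.edges ∧ ∃ w, w ∈ f ∧ w ∈ e}.ncard ≤
        (L e).card)
    (h : ∃ c, IsProperEdgeListColoring (G.deleteEdges {e | e ∈ p.edges}) L c) :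
    ∃ c, IsProperEdgeListColoring G L c := by
  classical
  obtain ⟨c, hcL, hc⟩ := h
  have hdel (e : Sym2 V) (he : e ∈ G.edgeSet) (hep : e ∉ p.edges) :
      e ∈ (G.deleteEdges {e | e ∈ p.edges}).edgeSet := by
    rw [SimpleGraph.edgeSet_deleteEdges]
    exact ⟨he, hep⟩
  have hlen := hp.three_le_length
  have : NeZero p.length := ⟨by omega⟩
  obtain ⟨u, hu, hmem⟩ := hp.exists_zmod_parametrization
  let N : Sym2 V → Set (Sym2 V) :=
    fun e => {f | f ∈ G.edgeSet ∧ f ∉ p.edges ∧ ∃ w, w ∈ f ∧ w ∈ e}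
  let M : Sym2 V → Finset ℕ := fun e => L e \ (Set.toFinite (N e)).toFinset.image c
  have hM (e : Sym2 V) (he : e ∈ p.edges) : 2 ≤ (M e).card := by
    have h1 : 2 + (N e).ncard ≤ (L e).card := hL e he
    rw [Set.ncard_eq_toFinset_card (N e)] at h1
    have h2 := Finset.le_card_sdiff ((Set.toFinite (N e)).toFinset.image c) (L e)
    have h3 := Finset.card_image_le (s := (Set.toFinite (N e)).toFinset) (f := c)
    dsimp only [M]
    omega
  obtain ⟨f, hf⟩ := exists_choice_ne_succ_of_even hev (fun j => M s(u j, u (j + 1)))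
    fun j => hM _ ((hmem _).mpr ⟨j, rfl⟩)
  choose idx hidx using fun e => (hmem e).mp
  let c' : Sym2 V → ℕ := fun e => if he : e ∈ p.edges then f (idx e he) else c e
  have hon (e : Sym2 V) (he : e ∈ p.edges) : c' e = f (idx e he) := dif_pos he
  have hoff (e : Sym2 V) (he : e ∉ p.edges) : c' e = c e := dif_neg he
  have hc'M (e : Sym2 V) (he : e ∈ p.edges) : c' e ∈ M e := by
    have := (hf (idx e he)).1
    rwa [hidx, ← hon] at this
  have hmixed (e d : Sym2 V) (he : e ∈ p.edges) (hd : d ∉ p.edges) (hdG : d ∈ G.edgeSet)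
      (hv : ∃ v, v ∈ d ∧ v ∈ e) : c' e ≠ c' d := by
    intro heq
    apply (Finset.mem_sdiff.mp (hc'M e he)).2
    rw [heq, hoff d hd]
    exact Finset.mem_image_of_mem c ((Set.Finite.mem_toFinset _).mpr ⟨hdG, hd, hv⟩)
  refine ⟨c', fun e he => ?_, fun e he d hd hne hv => ?_⟩
  · by_cases hep : e ∈ p.edges
    · exact (Finset.mem_sdiff.mp (hc'M e hep)).1
    · rw [hoff e hep]
      exact hcL e (hdel e he hep)
  · obtain ⟨v, hve, hvd⟩ := hv
    by_cases hep : e ∈ p.edges <;> by_cases hdp : d ∈ p.edges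
    · rw [hon e hep, hon d hdp]
      have hij : idx e hep ≠ idx d hdp := by
        intro hij
        apply hne
        rw [← hidx e hep, ← hidx d hdp, hij]
      rw [← hidx e hep, Sym2.mem_iff] at hve
      rw [← hidx d hdp, Sym2.mem_iff] at hvd
      rcases hve with rfl | rfl <;> rcases hvd with h | h
      · exact absurd (hu h) hij
      · rw [hu h]
        exact (hf _).2.symm
      · rw [← hu h]
        exact (hf _).2
      · exact absurd (add_right_cancel (hu h)) hij
    · exact hmixed e d hep hdp hd ⟨v, hvd, hve⟩
    · exact (hmixed d e hdp hep he ⟨v, hve, hvd⟩).symm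
    · rw [hoff e hep, hoff d hdp]
      exact hc e (hdel e he hep) d (hdel d hd hdp) hne ⟨v, hve, hvd⟩
end

section
/- Let G be a finite simple graph, let uv be an edge of G with d(u) ≤ 4 (degree in G), and let L assign a finite set of colors to each vertex and each edge of G with |L(uv)| ≥ d(u) + d(v) and |L(u)| ≥ 9. If the graph G − uv obtained by deleting the edge uv admits a proper total coloring from the lists L, then G admits a proper total coloring from the lists L. -/
/-- Let `G` be a finite simple graph, `uv` an edge with `d(u) ≤ 4`,
and `L` a list assignment on vertices and edges with `|L(uv)| ≥ d(u) + d(v)` and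
`|L(u)| ≥ 9`.  If `G - uv` has a proper total coloring from the lists, then so does
`G`. -/
theorem stmt_9 {V : Type*} [Fintype V] (G : SimpleGraph V) [DecidableRel G.Adj]
    (u v : V) (huv : G.Adj u v) (hdu : G.degree u ≤ 4)
    (Lv : V → Finset ℕ) (Le : Sym2 V → Finset ℕ)
    (hLuv : G.degree u + G.degree v ≤ (Le s(u, v)).card)
    (hLu : 9 ≤ (Lv u).card)
    (h : ∃ cv ce, IsProperTotalListColoring (G.deleteEdges {s(u, v)}) Lv Le cv ce) :
    ∃ cv ce, IsProperTotalListColoring G Lv Le cv ce := by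
  classical
  obtain ⟨cv, ce, hcv, hce, hvv, hee, hev⟩ := h
  have hadj : ∀ x y, G.Adj x y → s(x, y) ≠ s(u, v) →
      (G.deleteEdges {s(u, v)}).Adj x y := fun x y hxy hne => by
    simpa [SimpleGraph.deleteEdges_adj, hxy] using hne
  have hedge : ∀ e ∈ G.edgeSet, e ≠ s(u, v) →
      e ∈ (G.deleteEdges {s(u, v)}).edgeSet := fun e he hne => by
    rw [SimpleGraph.edgeSet_deleteEdges]
    exact ⟨he, hne⟩
  -- A color for `uv` that avoids `v` and the other edges at `u` and `v`.
  obtain ⟨a, haL, ha⟩ : ∃ a ∈ Le s(u, v),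
      a ∉ insert (cv v) (((G.neighborFinset u).erase v).image (fun x => ce s(u, x)) ∪
        ((G.neighborFinset v).erase u).image (fun x => ce s(v, x))) := by
    refine Finset.exists_mem_notMem_of_card_lt_card (lt_of_lt_of_le ?_ hLuv)
    have h1 := Finset.card_image_le (s := (G.neighborFinset u).erase v)
      (f := fun x => ce s(u, x))
    have h2 := Finset.card_image_le (s := (G.neighborFinset v).erase u)
      (f := fun x => ce s(v, x))
    rw [Finset.card_erase_of_mem (by simpa using huv), SimpleGraph.card_neighborFinset_eq_degree]
      at h1
    rw [Finset.card_erase_of_mem (by simpa using huv.symm),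
      SimpleGraph.card_neighborFinset_eq_degree] at h2
    have hu : 0 < G.degree u := G.degree_pos_iff_exists_adj u |>.2 ⟨v, huv⟩
    have hv : 0 < G.degree v := G.degree_pos_iff_exists_adj v |>.2 ⟨u, huv.symm⟩
    refine (Finset.card_insert_le _ _).trans_lt ?_
    have h3 := Finset.card_union_le (((G.neighborFinset u).erase v).image (fun x => ce s(u, x)))
      (((G.neighborFinset v).erase u).image (fun x => ce s(v, x)))
    omega
  set ce' := Function.update ce s(u, v) a
  have hce'_self : ce' s(u, v) = a := Function.update_self ..
  have hce'_ne : ∀ e, e ≠ s(u, v) → ce' e = ce e := fun e he => Function.update_of_ne he ..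
  have hav : a ≠ cv v := fun h => ha (by simp [h])
  have ha_edge : ∀ e ∈ G.edgeSet, e ≠ s(u, v) → (∃ w, w ∈ s(u, v) ∧ w ∈ e) → a ≠ ce e := by
    rintro e he hne ⟨w, hw, hwe⟩ h
    obtain ⟨x, rfl⟩ := Sym2.mem_iff_exists.1 hwe
    rw [SimpleGraph.mem_edgeSet] at he
    apply ha
    rw [Finset.mem_insert, Finset.mem_union, Finset.mem_image, Finset.mem_image]
    rcases Sym2.mem_iff.1 hw with rfl | rfl
    · refine .inr (.inl ⟨x, Finset.mem_erase.2 ⟨?_, by simpa using he⟩, h.symm⟩)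
      rintro rfl
      exact hne rfl
    · refine .inr (.inr ⟨x, Finset.mem_erase.2 ⟨?_, by simpa using he⟩, h.symm⟩)
      rintro rfl
      exact hne Sym2.eq_swap
  -- A new color for `u` that avoids its neighbors and all of its edges.
  obtain ⟨b, hbL, hb⟩ : ∃ b ∈ Lv u, b ∉ (G.neighborFinset u).image cv ∪
      (G.neighborFinset u).image (fun x => ce' s(u, x)) := by
    refine Finset.exists_mem_notMem_of_card_lt_card (lt_of_lt_of_le ?_ hLu)
    have h1 := Finset.card_image_le (s := G.neighborFinset u) (f := cv)
    have h2 := Finset.card_image_le (s := G.neighborFinset u) (f := fun x => ce' s(u, x))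
    have h3 := Finset.card_union_le ((G.neighborFinset u).image cv)
      ((G.neighborFinset u).image (fun x => ce' s(u, x)))
    rw [SimpleGraph.card_neighborFinset_eq_degree] at h1 h2
    omega
  have hb_vert : ∀ x, G.Adj u x → b ≠ cv x := fun x hx h =>
    hb (Finset.mem_union_left _ (Finset.mem_image.2 ⟨x, by simpa using hx, h.symm⟩))
  have hb_edge : ∀ x, G.Adj u x → b ≠ ce' s(u, x) := fun x hx h =>
    hb (Finset.mem_union_right _ (Finset.mem_image.2 ⟨x, by simpa using hx, h.symm⟩))
  have hcv'_ne : ∀ x, x ≠ u → Function.update cv u b x = cv x :=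
    fun x hx => Function.update_of_ne hx ..
  refine ⟨Function.update cv u b, ce', fun x => ?_, fun e he => ?_, fun x y hxy => ?_,
    fun e he f hf hne hef => ?_, fun e he x hx => ?_⟩
  · by_cases hx : x = u
    · subst hx
      simpa using hbL
    · rw [hcv'_ne x hx]
      exact hcv x
  · by_cases h : e = s(u, v)
    · rwa [h, hce'_self]
    · rw [hce'_ne e h]
      exact hce e (hedge e he h)
  · by_cases hx : x = u
    · subst hx
      rw [Function.update_self, hcv'_ne y hxy.ne']
      exact hb_vert y hxy
    by_cases hy : y = u
    · subst hy
      rw [Function.update_self, hcv'_ne x hx]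
      exact (hb_vert x hxy.symm).symm
    rw [hcv'_ne x hx, hcv'_ne y hy]
    refine hvv x y (hadj x y hxy fun h => ?_)
    rcases Sym2.mem_iff.1 (h ▸ Sym2.mem_mk_left u v : u ∈ s(x, y)) with h | h
    exacts [hx h.symm, hy h.symm]
  · by_cases h1 : e = s(u, v)
    · subst h1
      rw [hce'_self, hce'_ne f hne.symm]
      exact ha_edge f hf hne.symm hef
    by_cases h2 : f = s(u, v)
    · subst h2
      obtain ⟨w, hw, hw'⟩ := hef
      rw [hce'_self, hce'_ne e hne]
      exact (ha_edge e he hne ⟨w, hw', hw⟩).symm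
    rw [hce'_ne e h1, hce'_ne f h2]
    exact hee e (hedge e he h1) f (hedge f hf h2) hne hef
  · by_cases hxu : x = u
    · subst hxu
      obtain ⟨y, rfl⟩ := Sym2.mem_iff_exists.1 hx
      rw [Function.update_self]
      exact (hb_edge y he).symm
    rw [hcv'_ne x hxu]
    by_cases h : e = s(u, v)
    · subst h
      obtain rfl : x = v := (Sym2.mem_iff.1 hx).resolve_left hxu
      rwa [hce'_self]
    · rw [hce'_ne e h]
      exact hev e (hedge e he h) x hx
end
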